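/- arXiv:1204.0088 — 2 statements merged into one kernel-verified Lean document; each statement's English description precedes it below -/
import Mathlib

section
/- A triple (a, b, c) with a, b ∈ (1/2)ℤ, c ∈ ℤ, a + b ∈ ℤ, is equal to (A(P), (1/2)B(P), 1) for some (not necessarily convex) simple lattice polygon P if and only if c = 1 and a + 1 ≥ b ≥ 3/2. -/
open MeasureTheory

/-- The determinant of two vectors in `ℤ²`. -/
def det (p q : ℤ × ℤ) : ℤ := p.1 * q.2 - p.2 * q.1

/-- The dot product of two vectors in `ℤ²`. -/
def dot (p q : ℤ × ℤ) : ℤ := p.1 * q.1 + p.2 * q.2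

/-- A lattice point regarded as a complex number. -/
noncomputable def toC (p : ℤ × ℤ) : ℂ := ⟨(p.1 : ℝ), (p.2 : ℝ)⟩

/-- A lattice multi-polygon: a closed piecewise-linear loop `v` with vertices in
`ℤ²` and nondegenerate sides, together with a sign `ε i ∈ {±1}` on each side
`v_i v_{i+1}`, subject to the condition (⋆): whenever `v_{i-1}, v_i, v_{i+1}` are
collinear, the signs of the two adjacent sides agree if `v_i` lies between
`v_{i-1}` and `v_{i+1}` (the two side directions have positive dot product), and
differ if the loop reverses at `v_i` (negative dot product), i.e. if `v_{i-1}`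
lies on `v_i v_{i+1}` or `v_{i+1}` lies on `v_{i-1} v_i`. -/
def IsMultiPolygon {d : ℕ} (v : ZMod d → ℤ × ℤ) (ε : ZMod d → ℤ) : Prop :=
  (∀ i, ε i = 1 ∨ ε i = -1) ∧
  (∀ i, v i ≠ v (i + 1)) ∧
  (∀ i, det (v i - v (i - 1)) (v (i + 1) - v i) = 0 →
    (0 < dot (v i - v (i - 1)) (v (i + 1) - v i) → ε (i - 1) = ε i) ∧
    (dot (v i - v (i - 1)) (v (i + 1) - v i) < 0 → ε (i - 1) ≠ ε i))

/-- The winding number `d_P(x)` of the loop `v_1 → … → v_d → v_1` around a point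
`x` of the plane (valid off the loop). -/
noncomputable def windingAt {d : ℕ} [NeZero d] (v : ZMod d → ℤ × ℤ) (x : ℂ) : ℝ :=
  (2 * Real.pi)⁻¹ * ∑ i : ZMod d, Complex.arg ((toC (v (i + 1)) - x) / (toC (v i) - x))

/-- `A(P)`: the integral over the plane of the winding number of the loop. -/
noncomputable def polyA {d : ℕ} [NeZero d] (v : ZMod d → ℤ × ℤ) : ℝ :=
  ∫ x : ℂ, windingAt v x

/-- `B(P) = Σ ε_i |v_i v_{i+1}|`, where `|v_i v_{i+1}|` is the number of lattice
points on the side `v_i v_{i+1}` minus one, i.e. the gcd of the coordinate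
differences. -/
def polyB {d : ℕ} [NeZero d] (v : ZMod d → ℤ × ℤ) (ε : ZMod d → ℤ) : ℤ :=
  ∑ i : ZMod d, ε i * (Int.gcd ((v (i + 1)).1 - (v i).1) ((v (i + 1)).2 - (v i).2) : ℤ)

/-- The normal vector `n_i` to the side `v_i v_{i+1}`: the 90° (counterclockwise)
rotation of `ε_i n_i` points along `v_{i+1} − v_i`, so
`n_i = −i · ε_i · (v_{i+1} − v_i)` as a complex number. -/
noncomputable def normalVec {d : ℕ} (v : ZMod d → ℤ × ℤ) (ε : ZMod d → ℤ) (i : ZMod d) : ℂ :=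
  -Complex.I * (ε i : ℂ) * (toC (v (i + 1)) - toC (v i))

/-- `C(P)`: the rotation number of the sequence of normal vectors `n_1, …, n_d`. -/
noncomputable def polyC {d : ℕ} [NeZero d] (v : ZMod d → ℤ × ℤ) (ε : ZMod d → ℤ) : ℝ :=
  (2 * Real.pi)⁻¹ *
    ∑ i : ZMod d, Complex.arg (normalVec v ε (i + 1) / normalVec v ε i)

/-- A lattice point regarded as a point of the real plane. -/
def toR (p : ℤ × ℤ) : ℝ × ℝ := ((p.1 : ℝ), (p.2 : ℝ))

/-- The side `v_i v_{i+1}` as a segment in the real plane. -/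
def side {d : ℕ} (v : ZMod d → ℤ × ℤ) (i : ZMod d) : Set (ℝ × ℝ) :=
  segment ℝ (toR (v i)) (toR (v (i + 1)))

/-- A simple lattice polygon: the boundary is a simple closed polygonal curve
with vertices in `ℤ²`: sides are nondegenerate, adjacent sides meet exactly in
their common vertex, and non-adjacent sides are disjoint. -/
def IsSimplePolygon {d : ℕ} (v : ZMod d → ℤ × ℤ) : Prop :=
  3 ≤ d ∧
  (∀ i, v i ≠ v (i + 1)) ∧
  (∀ i, side v i ∩ side v (i + 1) = {toR (v (i + 1))}) ∧
  (∀ i j : ZMod d, i ≠ j → j ≠ i + 1 → i ≠ j + 1 → side v i ∩ side v j = ∅)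

def cr (a b : ℂ) : ℝ := a.re * b.im - a.im * b.re

lemma arg_add_k {x y : ℂ} (hx : x ≠ 0) (hy : y ≠ 0) :
    ∃ k : ℤ, x.arg + y.arg = (x * y).arg + 2 * Real.pi * k := by
  have h := Complex.arg_mul_coe_angle hx hy
  rw [← Real.Angle.coe_add, Real.Angle.angle_eq_iff_two_pi_dvd_sub] at h
  obtain ⟨k, hk⟩ := h
  refine ⟨-k, ?_⟩
  push_cast
  linarith

lemma div_im_cr (a b : ℂ) : (b / a).im = cr a b / Complex.normSq a := by
  rw [Complex.div_im, cr]; ring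

lemma arg_pos_of_cr {a b : ℂ} (h : 0 < cr a b) : 0 < (b / a).arg ∧ (b / a).arg < Real.pi := by
  have ha : a ≠ 0 := by rintro rfl; simp [cr] at h
  have h1 : 0 < (b / a).im := by
    rw [div_im_cr]; exact div_pos h (Complex.normSq_pos.2 ha)
  constructor
  · rcases (Complex.arg_nonneg_iff.2 h1.le).lt_or_eq with h2 | h2
    · exact h2
    · have := (Complex.arg_eq_zero_iff.1 h2.symm).2
      linarith
  · rcases (Complex.arg_le_pi (b / a)).lt_or_eq with h2 | h2
    · exact h2
    · have := (Complex.arg_eq_pi_iff.1 h2).2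
      linarith

lemma arg_neg_of_cr {a b : ℂ} (h : cr a b < 0) : (b / a).arg < 0 ∧ -Real.pi < (b / a).arg := by
  have ha : a ≠ 0 := by rintro rfl; simp [cr] at h
  have h1 : (b / a).im < 0 := by
    rw [div_im_cr]; exact div_neg_of_neg_of_pos h (Complex.normSq_pos.2 ha)
  exact ⟨Complex.arg_neg_iff.2 h1, Complex.neg_pi_lt_arg _⟩

lemma ne_zero_of_cr {a b : ℂ} (h : cr a b ≠ 0) : a ≠ 0 ∧ b ≠ 0 := by
  constructor <;> (rintro rfl; simp [cr] at h)

lemma arg_swap {a b : ℂ} (h : cr a b ≠ 0) : (a / b).arg = - (b / a).arg := by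
  rw [← inv_div, Complex.arg_inv, if_neg]
  intro h2
  rcases lt_or_gt_of_ne h with h1 | h1
  · have := arg_neg_of_cr h1
    linarith [Real.pi_pos]
  · have := arg_pos_of_cr h1
    linarith [Real.pi_pos]

/-- three args with product one -/
lemma arg_three {a b c : ℂ} (ha : a ≠ 0) (hb : b ≠ 0) (hc : c ≠ 0) :
    ∃ k : ℤ, (b / a).arg + (c / b).arg + (a / c).arg = 2 * Real.pi * k := by
  obtain ⟨k, hk⟩ := arg_add_k (div_ne_zero hb ha) (div_ne_zero hc hb)
  obtain ⟨l, hl⟩ := arg_add_k (mul_ne_zero (div_ne_zero hb ha) (div_ne_zero hc hb)) (div_ne_zero ha hc)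
  have e : b / a * (c / b) * (a / c) = 1 := by field_simp
  rw [e, Complex.arg_one] at hl
  refine ⟨k + l, ?_⟩
  push_cast
  linarith

lemma int_of_bounds {S : ℝ} {k : ℤ} (h : S = 2 * Real.pi * k) (m : ℤ)
    (h1 : 2 * Real.pi * (m - 1) < S) (h2 : S < 2 * Real.pi * (m + 1)) : S = 2 * Real.pi * m := by
  have hp := Real.pi_pos
  have a1 : (m : ℝ) - 1 < k := by
    rw [h] at h1; exact lt_of_mul_lt_mul_left h1 (by positivity)
  have a2 : (k : ℝ) < m + 1 := by
    rw [h] at h2; exact lt_of_mul_lt_mul_left h2 (by positivity)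
  have : k = m := by
    have b1 : m - 1 < k := by exact_mod_cast a1
    have b2 : k < m + 1 := by exact_mod_cast a2
    omega
  rw [h, this]

/-- the (unnormalised) winding of the triangle `0, a, b` around `x`. -/
noncomputable def tri (a b x : ℂ) : ℝ :=
  ((a - x) / (0 - x)).arg + ((b - x) / (a - x)).arg + ((0 - x) / (b - x)).arg

/-- open triangle -/
def triSet (a b : ℂ) : Set ℂ := {x | 0 < cr x (b) * cr a b ∧ 0 < cr a x * cr a b ∧
  0 < (cr a b - cr x b - cr a x) * cr a b}

lemma tri_pos {a b x : ℂ} (h : 0 < cr a b) (h1 : cr (0 - x) (a - x) ≠ 0) (h2 : cr (a - x) (b - x) ≠ 0)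
    (h3 : cr (b - x) (0 - x) ≠ 0) : tri a b x = 2 * Real.pi * (triSet a b).indicator 1 x := by
  have hp := Real.pi_pos
  obtain ⟨k, hk⟩ := arg_three (ne_zero_of_cr h1).1 (ne_zero_of_cr h1).2 (ne_zero_of_cr h2).2
  have e1 : cr (0 - x) (a - x) = cr a x := by simp [cr]; ring
  have e2 : cr (a - x) (b - x) = cr a b - cr x b - cr a x := by simp [cr]; ring
  have e3 : cr (b - x) (0 - x) = cr x b := by simp [cr]; ring
  unfold tri
  by_cases hx : x ∈ triSet a b
  · rw [Set.indicator_of_mem hx]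
    have hx1 : 0 < cr x b := by have := hx.1; exact pos_of_mul_pos_left this h.le
    have hx2 : 0 < cr a x := by have := hx.2.1; exact pos_of_mul_pos_left this h.le
    have hx3 : 0 < cr a b - cr x b - cr a x := by have := hx.2.2; exact pos_of_mul_pos_left this h.le
    rw [← e1] at hx2; rw [← e2] at hx3; rw [← e3] at hx1
    have a1 := arg_pos_of_cr hx1
    have a2 := arg_pos_of_cr hx2
    have a3 := arg_pos_of_cr hx3
    have := int_of_bounds hk 1 (by push_cast; linarith) (by push_cast; linarith)
    rw [this]; simp
  · rw [Set.indicator_of_notMem hx]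
    have key : ¬ (0 < cr x b ∧ 0 < cr a x ∧ 0 < cr a b - cr x b - cr a x) := by
      intro ⟨q1, q2, q3⟩
      exact hx ⟨mul_pos q1 h, mul_pos q2 h, mul_pos q3 h⟩
    have : ((a - x) / (0 - x)).arg + ((b - x) / (a - x)).arg + ((0 - x) / (b - x)).arg = 2 * Real.pi * (0 : ℤ) := by
      rcases lt_or_gt_of_ne h1 with g1 | g1 <;> rcases lt_or_gt_of_ne h2 with g2 | g2 <;>
        rcases lt_or_gt_of_ne h3 with g3 | g3
      · rw [e1] at g1; rw [e2] at g2; rw [e3] at g3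
        linarith
      · have a1 := arg_neg_of_cr g1
        have a2 := arg_neg_of_cr g2
        have a3 := arg_pos_of_cr g3
        exact int_of_bounds hk 0 (by push_cast; linarith) (by push_cast; linarith)
      · have a1 := arg_neg_of_cr g1
        have a2 := arg_pos_of_cr g2
        have a3 := arg_neg_of_cr g3
        exact int_of_bounds hk 0 (by push_cast; linarith) (by push_cast; linarith)
      · have a1 := arg_neg_of_cr g1
        have a2 := arg_pos_of_cr g2
        have a3 := arg_pos_of_cr g3
        exact int_of_bounds hk 0 (by push_cast; linarith) (by push_cast; linarith)
      · have a1 := arg_pos_of_cr g1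
        have a2 := arg_neg_of_cr g2
        have a3 := arg_neg_of_cr g3
        exact int_of_bounds hk 0 (by push_cast; linarith) (by push_cast; linarith)
      · have a1 := arg_pos_of_cr g1
        have a2 := arg_neg_of_cr g2
        have a3 := arg_pos_of_cr g3
        exact int_of_bounds hk 0 (by push_cast; linarith) (by push_cast; linarith)
      · have a1 := arg_pos_of_cr g1
        have a2 := arg_pos_of_cr g2
        have a3 := arg_neg_of_cr g3
        exact int_of_bounds hk 0 (by push_cast; linarith) (by push_cast; linarith)
      · rw [e1] at g1; rw [e2] at g2; rw [e3] at g3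
        exact absurd ⟨g3, g1, g2⟩ key
    rw [this]; simp

lemma triSet_swap (a b : ℂ) : triSet a b = triSet b a := by
  ext x
  have e (p q : ℂ) : cr p q = - cr q p := by simp [cr]; ring
  simp only [triSet, Set.mem_ofPred_eq]
  rw [e a b, e x b, e a x]
  constructor
  · rintro ⟨h1, h2, h3⟩; exact ⟨by linarith, by linarith, by linarith⟩
  · rintro ⟨h1, h2, h3⟩; exact ⟨by linarith, by linarith, by linarith⟩

lemma tri_swap {a b x : ℂ} (h1 : cr (0 - x) (a - x) ≠ 0) (h2 : cr (a - x) (b - x) ≠ 0)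
    (h3 : cr (b - x) (0 - x) ≠ 0) : tri b a x = - tri a b x := by
  unfold tri
  rw [arg_swap h1, arg_swap h2, arg_swap h3]; ring

/-- lines are null -/
lemma ae_line {a b : ℂ} (h : a ≠ b) : ∀ᵐ x : ℂ, cr (a - x) (b - x) ≠ 0 := by
  have hs : MeasureTheory.volume ((AffineSubspace.mk' a (LinearMap.ker
      ((b - a).im • Complex.reLm - (b - a).re • Complex.imLm)) : AffineSubspace ℝ ℂ) : Set ℂ) = 0 := by
    apply MeasureTheory.Measure.addHaar_affineSubspace
    intro h2
    have h3 : ∀ y : ℂ, y ∈ AffineSubspace.mk' a (LinearMap.ker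
      ((b - a).im • Complex.reLm - (b - a).re • Complex.imLm)) := by
      intro y; rw [h2]; trivial
    have h4 := h3 (a + 1)
    have h5 := h3 (a + Complex.I)
    rw [AffineSubspace.mem_mk'] at h4 h5
    simp at h4 h5
    apply h
    apply Complex.ext <;> linarith
  rw [ae_iff]
  refine measure_mono_null ?_ hs
  intro x hx
  simp only [ne_eq, not_not, Set.mem_ofPred_eq] at hx
  rw [SetLike.mem_coe, AffineSubspace.mem_mk']
  simp [cr] at hx ⊢
  linarith

noncomputable def linAB (a b : ℂ) : ℂ →ₗ[ℝ] ℂ := Complex.reLm.smulRight a + Complex.imLm.smulRight b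

lemma linAB_det (a b : ℂ) : LinearMap.det (linAB a b) = cr a b := by
  rw [← LinearMap.det_toMatrix Complex.basisOneI, Matrix.det_fin_two]
  simp [LinearMap.toMatrix_apply, linAB, cr]
  ring

def std : Set ℂ := {x | 0 < x.re ∧ 0 < x.im ∧ x.re + x.im < 1}

lemma vol_std : volume std = ENNReal.ofReal (1 / 2) := by
  have e : std = Complex.measurableEquivRealProd ⁻¹' (regionBetween (fun _ => 0) (fun s => 1 - s) (Set.Ioo 0 1)) := by
    ext x
    simp only [std, regionBetween, Set.mem_ofPred_eq, Set.mem_preimage, Complex.measurableEquivRealProd_apply, Set.mem_Ioo]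
    constructor
    · rintro ⟨h1, h2, h3⟩; exact ⟨⟨h1, by linarith⟩, h2, by linarith⟩
    · rintro ⟨⟨h1, _⟩, h2, h3⟩; exact ⟨h1, h2, by linarith⟩
  rw [e, Complex.volume_preserving_equiv_real_prod.measure_preimage_equiv]
  change (volume.prod volume) _ = _
  rw [volume_regionBetween_eq_integral]
  · congr 1
    rw [← MeasureTheory.integral_Ioc_eq_integral_Ioo, ← intervalIntegral.integral_of_le zero_le_one]
    simp only [sub_zero, Pi.sub_apply]
    rw [intervalIntegral.integral_sub (by simp) (by simp)]
    simp
    norm_num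
  · exact (continuous_const.integrableOn_Icc (a := 0) (b := 1)).mono_set Set.Ioo_subset_Icc_self
  · exact ((continuous_const.sub continuous_id).integrableOn_Icc (a := 0) (b := 1)).mono_set Set.Ioo_subset_Icc_self
  · exact measurableSet_Ioo
  · intro x hx; simp at hx ⊢; linarith

lemma triSet_eq {a b : ℂ} (h : 0 < cr a b) : triSet a b = linAB a b '' std := by
  ext x
  constructor
  · rintro ⟨h1, h2, h3⟩
    have hx1 : 0 < cr x b := pos_of_mul_pos_left h1 h.le
    have hx2 : 0 < cr a x := pos_of_mul_pos_left h2 h.le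
    have hx3 : 0 < cr a b - cr x b - cr a x := pos_of_mul_pos_left h3 h.le
    refine ⟨⟨cr x b / cr a b, cr a x / cr a b⟩, ⟨div_pos hx1 h, div_pos hx2 h, ?_⟩, ?_⟩
    · simp only; rw [← add_div, div_lt_one h]; linarith
    · simp only [linAB]
      have h' := h.ne'
      apply Complex.ext
      · simp; field_simp; simp only [cr]; ring
      · simp; field_simp; simp only [cr]; ring
  · rintro ⟨y, ⟨h1, h2, h3⟩, rfl⟩
    have e1 : cr (linAB a b y) b = y.re * cr a b := by simp [linAB, cr]; ring
    have e2 : cr a (linAB a b y) = y.im * cr a b := by simp [linAB, cr]; ring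
    refine ⟨?_, ?_, ?_⟩
    · rw [e1]; positivity
    · rw [e2]; positivity
    · rw [e1, e2]
      have : 0 < 1 - y.re - y.im := by linarith
      have : 0 < (1 - y.re - y.im) * (cr a b * cr a b) := by positivity
      linarith

lemma vol_triSet {a b : ℂ} (h : 0 < cr a b) : volume (triSet a b) = ENNReal.ofReal (cr a b / 2) := by
  rw [triSet_eq h, MeasureTheory.Measure.addHaar_image_linearMap, linAB_det, vol_std, ← ENNReal.ofReal_mul (abs_nonneg _),
    abs_of_pos h]
  congr 1; ring

lemma cr_cont_l (b : ℂ) : Continuous fun x => cr x b := by unfold cr; fun_prop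
lemma cr_cont_r (b : ℂ) : Continuous fun x => cr b x := by unfold cr; fun_prop

lemma meas_triSet (a b : ℂ) : MeasurableSet (triSet a b) := by
  have h1 := cr_cont_l b
  have h2 := cr_cont_r a
  apply IsOpen.measurableSet
  exact (isOpen_lt continuous_const (h1.mul continuous_const)).inter
    ((isOpen_lt continuous_const (h2.mul continuous_const)).inter
    (isOpen_lt continuous_const (((continuous_const.sub h1).sub h2).mul continuous_const)))

lemma tri_int_pos {a b : ℂ} (h : 0 < cr a b) :
    Integrable (tri a b) ∧ ∫ x, tri a b x = Real.pi * cr a b := by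
  obtain ⟨ha, hb⟩ := ne_zero_of_cr h.ne'
  have hab : a ≠ b := by rintro rfl; simp [cr] at h; linarith
  have hae : tri a b =ᵐ[volume] fun x => 2 * Real.pi * (triSet a b).indicator 1 x := by
    filter_upwards [ae_line ha.symm, ae_line hab, ae_line hb] with x h1 h2 h3
    exact tri_pos h h1 h2 h3
  have hv := vol_triSet h
  have hi : Integrable ((triSet a b).indicator (1 : ℂ → ℝ)) := by
    rw [integrable_indicator_iff (meas_triSet a b)]
    apply integrableOn_const
    · rw [hv]; exact ENNReal.ofReal_ne_top
    · simp
  refine ⟨(integrable_congr hae).2 (hi.const_mul _), ?_⟩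
  rw [integral_congr_ae hae, integral_const_mul, integral_indicator_one (meas_triSet a b), Measure.real, hv,
    ENNReal.toReal_ofReal (by positivity)]
  ring

lemma tri_int (a b : ℂ) : Integrable (tri a b) ∧ ∫ x, tri a b x = Real.pi * cr a b := by
  rcases lt_trichotomy (cr a b) 0 with h | h | h
  · have e : cr b a = - cr a b := by simp [cr]; ring
    obtain ⟨h1, h2⟩ := tri_int_pos (a := b) (b := a) (by linarith)
    obtain ⟨ha, hb⟩ := ne_zero_of_cr h.ne
    have hab : a ≠ b := by rintro rfl; linarith
    have hae : tri a b =ᵐ[volume] fun x => - tri b a x := by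
      filter_upwards [ae_line hb.symm, ae_line hab.symm, ae_line ha] with x h1 h2 h3
      exact tri_swap h1 h2 h3
    refine ⟨(integrable_congr hae).2 h1.neg, ?_⟩
    rw [integral_congr_ae hae, integral_neg, h2, e]; ring
  · have hae : tri a b =ᵐ[volume] fun x => 0 := by
      by_cases ha : a = 0
      · subst ha
        by_cases hb : b = 0
        · subst hb
          filter_upwards [] with x
          unfold tri
          by_cases hx : x = 0 <;> simp [hx]
        · filter_upwards [ae_line hb, compl_mem_ae_iff.2 (measure_singleton (0:ℂ))] with x h3 hx
          unfold tri
          have : (0 : ℂ) - x ≠ 0 := by simpa using hx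
          rw [arg_swap h3, div_self this]; simp
      by_cases hb : b = 0
      · subst hb
        filter_upwards [ae_line ha, compl_mem_ae_iff.2 (measure_singleton (0:ℂ))] with x h3 hx
        unfold tri
        have : (0 : ℂ) - x ≠ 0 := by simpa using hx
        rw [arg_swap h3, div_self this]; simp
      by_cases hab : a = b
      · subst hab
        filter_upwards [ae_line ha] with x h3
        unfold tri
        rw [arg_swap h3, div_self (ne_zero_of_cr h3).1]; simp
      filter_upwards [ae_line (Ne.symm ha), ae_line hab, ae_line hb] with x h1 h2 h3
      have hp := Real.pi_pos
      obtain ⟨k, hk⟩ := arg_three (ne_zero_of_cr h1).1 (ne_zero_of_cr h1).2 (ne_zero_of_cr h2).2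
      have e : cr (0 - x) (a - x) + cr (a - x) (b - x) + cr (b - x) (0 - x) = 0 := by
        rw [← h]; simp [cr]; ring
      unfold tri
      have : ((a - x) / (0 - x)).arg + ((b - x) / (a - x)).arg + ((0 - x) / (b - x)).arg = 2 * Real.pi * (0 : ℤ) := by
        rcases lt_or_gt_of_ne h1 with g1 | g1 <;> rcases lt_or_gt_of_ne h2 with g2 | g2 <;>
          rcases lt_or_gt_of_ne h3 with g3 | g3 <;>
        first
        | linarith
        | (first | have a1 := arg_neg_of_cr g1 | have a1 := arg_pos_of_cr g1
           first | have a2 := arg_neg_of_cr g2 | have a2 := arg_pos_of_cr g2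
           first | have a3 := arg_neg_of_cr g3 | have a3 := arg_pos_of_cr g3
           exact int_of_bounds hk 0 (by push_cast; linarith) (by push_cast; linarith))
      rw [this]; simp
    refine ⟨(integrable_congr hae).2 (integrable_zero _ _ _), ?_⟩
    rw [integral_congr_ae hae, h]; simp
  · exact tri_int_pos h

lemma polyA_eq {d : ℕ} [NeZero d] (v : ZMod d → ℤ × ℤ) :
    polyA v = (∑ i : ZMod d, cr (toC (v i)) (toC (v (i + 1)))) / 2 := by
  have hae : windingAt v =ᵐ[volume] fun x => (2 * Real.pi)⁻¹ * ∑ i : ZMod d, tri (toC (v i)) (toC (v (i + 1))) x := by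
    have : ∀ᵐ x : ℂ, ∀ i : ZMod d, ((0 - x) / (toC (v i) - x)).arg = - ((toC (v i) - x) / (0 - x)).arg := by
      rw [ae_all_iff]
      intro i
      by_cases h : toC (v i) = 0
      · filter_upwards [compl_mem_ae_iff.2 (measure_singleton (0:ℂ))] with x hx
        have : (0 : ℂ) - x ≠ 0 := by simpa using hx
        rw [h, div_self this]; simp
      · filter_upwards [ae_line (Ne.symm h)] with x hx
        exact arg_swap hx
    filter_upwards [this] with x hx
    unfold windingAt tri
    congr 1
    rw [Finset.sum_add_distrib, Finset.sum_add_distrib]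
    have : ∑ i : ZMod d, ((0 - x) / (toC (v (i + 1)) - x)).arg = - ∑ i : ZMod d, ((toC (v i) - x) / (0 - x)).arg := by
      rw [← Finset.sum_neg_distrib, ← Equiv.sum_comp (Equiv.addRight (1 : ZMod d)) fun i => -((toC (v i) - x) / (0 - x)).arg]
      apply Finset.sum_congr rfl
      intro i _
      exact hx (i + 1)
    rw [this]; ring
  unfold polyA
  rw [integral_congr_ae hae, integral_const_mul, integral_finsetSum _ (fun i _ => (tri_int _ _).1)]
  simp_rw [(tri_int _ _).2]
  rw [← Finset.mul_sum]
  have := Real.pi_pos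
  field_simp

structure SP (d : ℕ) (z : ℕ → ℂ) : Prop where
  three : 3 ≤ d
  per : ∀ k, z (k + d) = z k
  ne : ∀ k, k < d → z k ≠ z (k + 1)
  inter : ∀ i j, i < j → j < d → ∀ x, x ∈ segment ℝ (z i) (z (i + 1)) →
    x ∈ segment ℝ (z j) (z (j + 1)) → (j = i + 1 ∧ x = z j) ∨ (i = 0 ∧ j + 1 = d ∧ x = z 0)

noncomputable def turn (d : ℕ) (z : ℕ → ℂ) : ℝ :=
  ∑ k ∈ Finset.range d, ((z (k + 2) - z (k + 1)) / (z (k + 1) - z k)).arg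

def lpos (c : ℂ) : Prop := 0 < c.re ∨ (c.re = 0 ∧ 0 < c.im)

/-- vertex `k` is extreme -/
def ExtV (d : ℕ) (z : ℕ → ℂ) (k : ℕ) : Prop :=
  ∃ ω : ℂ, ω ≠ 0 ∧ ∀ j, j < d → j ≠ k → lpos (ω * (z j - z k))

lemma lpos_ne {c : ℂ} (h : lpos c) : c ≠ 0 := by
  rintro rfl; simp [lpos] at h

lemma lpos_arg {c : ℂ} (h : lpos c) : -(Real.pi / 2) < c.arg ∧ c.arg ≤ Real.pi / 2 := by
  rcases h with h | ⟨h, h'⟩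
  · have := Complex.abs_arg_lt_pi_div_two_iff.2 (Or.inl h)
    rw [abs_lt] at this
    exact ⟨this.1, this.2.le⟩
  · have : c.arg = Real.pi / 2 := Complex.arg_eq_pi_div_two_iff.2 ⟨h, h'⟩
    rw [this]; constructor <;> linarith [Real.pi_pos]

lemma arg_div_lpos {ω a b : ℂ} (hω : ω ≠ 0) (ha : lpos (ω * a)) (hb : lpos (ω * b)) :
    (b / a).arg = (ω * b).arg - (ω * a).arg := by
  have e : b / a = (ω * b) / (ω * a) := by rw [mul_div_mul_left _ _ hω]
  have h1 := lpos_arg ha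
  have h2 := lpos_arg hb
  have ha' := lpos_ne ha
  have hb' := lpos_ne hb
  obtain ⟨k, hk⟩ := arg_add_k (div_ne_zero hb' ha') ha'
  rw [div_mul_cancel₀ _ ha'] at hk
  rw [e]
  have h3 := Complex.neg_pi_lt_arg ((ω * b) / (ω * a))
  have h4 := Complex.arg_le_pi ((ω * b) / (ω * a))
  have hp := Real.pi_pos
  have hk' : ((ω * b) / (ω * a)).arg + (ω * a).arg - (ω * b).arg = 2 * Real.pi * k := by linarith
  have := int_of_bounds hk' 0 (by push_cast; linarith) (by push_cast; linarith)
  push_cast at this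
  linarith

lemma half_of_f (f : ℂ →L[ℝ] ℝ) : ∃ ω : ℂ, ∀ x, (ω * x).re = f x := by
  refine ⟨⟨f 1, - f Complex.I⟩, fun x => ?_⟩
  have : x = x.re • (1 : ℂ) + x.im • Complex.I := by apply Complex.ext <;> simp
  conv_rhs => rw [this]
  rw [map_add, map_smul, map_smul]
  simp; ring

lemma sep_seg {a b c e : ℂ} (h : ∀ x, x ∈ segment ℝ a b → x ∈ segment ℝ c e → False) :
    ∃ ω : ℂ, ω ≠ 0 ∧ ∀ x ∈ segment ℝ a b, ∀ y ∈ segment ℝ c e, lpos (ω * (y - x)) := by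
  have comp (p q : ℂ) : IsCompact (segment ℝ p q) := by
    rw [segment_eq_image]
    exact isCompact_Icc.image (by fun_prop)
  obtain ⟨f, u, v, h1, h2, h3⟩ := geometric_hahn_banach_compact_closed (convex_segment a b) (comp a b)
    (convex_segment c e) (comp c e).isClosed (Set.disjoint_left.2 h)
  obtain ⟨ω, hω⟩ := half_of_f f
  have key : ∀ x ∈ segment ℝ a b, ∀ y ∈ segment ℝ c e, 0 < (ω * (y - x)).re := by
    intro x hx y hy
    rw [hω, map_sub]; linarith [h1 x hx, h3 y hy]
  refine ⟨ω, ?_, fun x hx y hy => Or.inl (key x hx y hy)⟩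
  rintro rfl
  have := key a (left_mem_segment _ _ _) c (left_mem_segment _ _ _)
  simp at this

section
variable {d : ℕ} {z : ℕ → ℂ} 

lemma SP.square (h : SP d z) {i j : ℕ} (hij : i + 1 < j) (hj : j < d) (hne : ¬ (i = 0 ∧ j + 1 = d)) :
    ((z (j+1) - z i) / (z j - z i)).arg + ((z (j+1) - z (i+1)) / (z (j+1) - z i)).arg =
    ((z j - z (i+1)) / (z j - z i)).arg + ((z (j+1) - z (i+1)) / (z j - z (i+1))).arg := by
  obtain ⟨ω, hω, H⟩ := sep_seg (a := z i) (b := z (i+1)) (c := z j) (e := z (j+1)) (by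
    intro x hx hy
    rcases h.inter i j (by omega) hj x hx hy with h1 | h1
    · omega
    · exact hne ⟨h1.1, h1.2.1⟩)
  have a1 := left_mem_segment ℝ (z i) (z (i+1))
  have a2 := right_mem_segment ℝ (z i) (z (i+1))
  have b1 := left_mem_segment ℝ (z j) (z (j+1))
  have b2 := right_mem_segment ℝ (z j) (z (j+1))
  have c1 := H _ a1 _ b1
  have c2 := H _ a1 _ b2
  have c3 := H _ a2 _ b1
  have c4 := H _ a2 _ b2
  rw [arg_div_lpos hω c1 c2, arg_div_lpos hω c2 c4, arg_div_lpos hω c1 c3, arg_div_lpos hω c3 c4]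
  ring

lemma SP.triangle (h : SP d z) {i : ℕ} (hi : i + 1 < d) :
    ((z (i+2) - z (i+1)) / (z (i+1) - z i)).arg =
    ((z (i+2) - z i) / (z (i+1) - z i)).arg + ((z (i+2) - z (i+1)) / (z (i+2) - z i)).arg := by
  set a := z (i+1) - z i with ha
  set b := z (i+2) - z (i+1) with hb
  have hab : z (i+2) - z i = a + b := by rw [ha, hb]; ring
  have hane : a ≠ 0 := by rw [ha]; exact sub_ne_zero.2 (h.ne i (by omega)).symm
  have hbne : b ≠ 0 := by rw [hb]; exact sub_ne_zero.2 (h.ne (i+1) (by omega)).symm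
  obtain ⟨ω, hω, H⟩ := sep_seg (a := 0) (b := 0) (c := a) (e := b) (by
    intro x hx hy
    rw [segment_same] at hx
    obtain rfl : x = 0 := hx
    obtain ⟨s, t, hs, ht, hst, e⟩ := hy
    have hs1 : s ≠ 0 := by
      rintro rfl
      have : t = 1 := by linarith
      subst this
      simp at e; exact hbne e
    have X := h.inter i (i+1) (by omega) hi (z (i+1) - s • a) ⟨s, 1 - s, hs, by linarith, by ring, by
      rw [ha]; simp; ring⟩ ⟨1 - t, t, by linarith, ht, by ring, by
      have e' : s • a = - (t • b) := by linear_combination e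
      rw [e', hb]; simp; ring⟩
    have : z (i+1) - s • a = z (i+1) ∨ i = 0 ∧ i + 1 + 1 = d := by
      rcases X with X | X
      · exact Or.inl X.2
      · exact Or.inr ⟨X.1, X.2.1⟩
    rcases this with h1 | h1
    · have : s • a = 0 := by linear_combination -h1
      rcases smul_eq_zero.1 this with h2 | h2
      · exact hs1 h2
      · exact hane h2
    · have := h.three; omega)
  have z0 : (0:ℂ) ∈ segment ℝ (0:ℂ) 0 := left_mem_segment ℝ 0 0
  have c1 := H 0 z0 a (left_mem_segment ℝ a b)
  have c2 := H 0 z0 b (right_mem_segment ℝ a b)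
  rw [sub_zero] at c1 c2
  obtain ⟨ω', hω', H'⟩ : ∃ ω' : ℂ, ω' ≠ 0 ∧ (lpos (ω' * a) ∧ lpos (ω' * b) ∧ lpos (ω' * (a + b))) := by
    refine ⟨ω, hω, c1, c2, ?_⟩
    rw [mul_add]
    unfold lpos at *
    simp only [Complex.add_re, Complex.add_im]
    rcases c1 with c1 | c1 <;> rcases c2 with c2 | c2
    · left; linarith
    · left; linarith
    · left; linarith
    · right; constructor <;> linarith
  obtain ⟨c1, c2, c3⟩ := H'
  rw [hab, arg_div_lpos hω' c1 c2, arg_div_lpos hω' c1 c3, arg_div_lpos hω' c3 c2]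
  ring

lemma SP.path (h : SP d z) (m : ℕ) (hm : m + 2 ≤ d) :
    ∑ i ∈ Finset.range m, ((z (i+2) - z (i+1)) / (z (i+1) - z i)).arg =
    ∑ j ∈ Finset.range m, ((z (j+2) - z 0) / (z (j+1) - z 0)).arg +
    ∑ i ∈ Finset.range m, ((z (m+1) - z (i+1)) / (z (m+1) - z i)).arg := by
  induction m with
  | zero => simp
  | succ m ih =>
    rw [Finset.sum_range_succ, ih (by omega), h.triangle (by omega : m + 1 < d)]
    have key : ∀ n, n ≤ m → ∑ i ∈ Finset.range n, ((z (m+1) - z (i+1)) / (z (m+1) - z i)).arg +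
        ((z (m+2) - z n) / (z (m+1) - z n)).arg = ((z (m+2) - z 0) / (z (m+1) - z 0)).arg + 
        ∑ i ∈ Finset.range n, ((z (m+2) - z (i+1)) / (z (m+2) - z i)).arg := by
      intro n hn
      induction n with
      | zero => simp
      | succ n ihn =>
        have := ihn (by omega)
        have sq := h.square (i := n) (j := m+1) (by omega) (by omega) (by omega)
        rw [Finset.sum_range_succ, Finset.sum_range_succ]
        linarith
    have := key m le_rfl
    rw [Finset.sum_range_succ, Finset.sum_range_succ]
    linarith

lemma SP.path2 (h : SP (d+3) z) :
    ∑ i ∈ Finset.range (d+2), ((z (i+2) - z (i+1)) / (z (i+1) - z i)).arg =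
    ∑ j ∈ Finset.range (d+1), ((z (j+2) - z 0) / (z (j+1) - z 0)).arg +
    ((z (d+2) - z 1) / (z (d+2) - z 0)).arg + ((z 0 - z 1) / (z (d+2) - z 1)).arg + 
    ∑ i ∈ Finset.range (d+1), ((z 0 - z (i+2)) / (z 0 - z (i+1))).arg := by
  have hz : z (d+3) = z 0 := by have := h.per 0; rwa [zero_add] at this
  rw [Finset.sum_range_succ, h.path (d+1) (by omega), h.triangle (by omega : d + 1 + 1 < d+3)]
  have key : ∀ n, n ≤ d → ∑ i ∈ Finset.range n, ((z (d+2) - z (i+2)) / (z (d+2) - z (i+1))).arg +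
        ((z (d+3) - z (n+1)) / (z (d+2) - z (n+1))).arg = ((z (d+3) - z 1) / (z (d+2) - z 1)).arg + 
        ∑ i ∈ Finset.range n, ((z (d+3) - z (i+2)) / (z (d+3) - z (i+1))).arg := by
      intro n hn
      induction n with
      | zero => simp
      | succ n ihn =>
        have := ihn (by omega)
        have sq := h.square (i := n+1) (j := d+2) (by omega) (by omega) (by omega)
        rw [Finset.sum_range_succ, Finset.sum_range_succ]
        linarith
  have := key d le_rfl
  rw [← hz]
  rw [Finset.sum_range_succ (fun i => ((z (d+3) - z (i+2)) / (z (d+3) - z (i+1))).arg) d]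
  rw [Finset.sum_range_succ' (fun i => ((z (d + 1 + 1) - z (i+1)) / (z (d + 1 + 1) - z i)).arg) d]
  simp only [zero_add, add_assoc, Nat.reduceAdd] at *
  rw [hz] at this ⊢
  linarith

lemma six {u w : ℂ} {s : ℝ} (hs : s = 1 ∨ s = -1) (h : 0 < s * cr w u) :
    2 * (u / w).arg + ((u - w) / u).arg + ((-w) / (u - w)).arg + (w / (-u)).arg = 2 * Real.pi * s := by
  have hp := Real.pi_pos
  have hne : cr w u ≠ 0 := by rintro h0; rw [h0] at h; simp at h
  obtain ⟨hw, hu⟩ := ne_zero_of_cr hne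
  have e1 : cr u (u - w) = cr w u := by simp [cr]; ring
  have e2 : cr (u - w) (-w) = cr w u := by simp [cr]; ring
  have e3 : cr (-u) w = cr w u := by simp [cr]; ring
  have huw : u - w ≠ 0 := (ne_zero_of_cr (e1.trans_ne hne)).2
  obtain ⟨k, hk⟩ := arg_add_k (div_ne_zero hu hw) (div_ne_zero hw (neg_ne_zero.2 hu))
  have p1 : u / w * (w / (-u)) = -1 := by field_simp
  rw [p1, Complex.arg_neg_one] at hk
  obtain ⟨l, hl⟩ := arg_add_k (div_ne_zero hu hw) (div_ne_zero huw hu)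
  obtain ⟨m, hm⟩ := arg_add_k (mul_ne_zero (div_ne_zero hu hw) (div_ne_zero huw hu)) (div_ne_zero (neg_ne_zero.2 hw) huw)
  have p2 : u / w * ((u - w) / u) * (-w / (u - w)) = -1 := by field_simp
  rw [p2, Complex.arg_neg_one] at hm
  have hk' : (u / w).arg + (w / (-u)).arg - Real.pi = 2 * Real.pi * k := by linarith
  have hl' : (u / w).arg + ((u - w) / u).arg + ((-w) / (u - w)).arg - Real.pi = 2 * Real.pi * ((l + m : ℤ) : ℝ) := by
    push_cast; linarith
  rcases hs with rfl | rfl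
  · rw [one_mul] at h
    have a0 := arg_pos_of_cr h
    have a1 := arg_pos_of_cr (h.trans_eq e1.symm)
    have a2 := arg_pos_of_cr (h.trans_eq e2.symm)
    have a3 := arg_pos_of_cr (h.trans_eq e3.symm)
    have b1 := int_of_bounds hk' 0 (by push_cast; linarith) (by push_cast; linarith)
    have b2 := int_of_bounds hl' 0 (by push_cast; linarith) (by push_cast; linarith)
    push_cast at b1 b2
    linarith
  · have h : cr w u < 0 := by linarith
    have a0 := arg_neg_of_cr h
    have a1 := arg_neg_of_cr (e1.trans_lt h)
    have a2 := arg_neg_of_cr (e2.trans_lt h)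
    have a3 := arg_neg_of_cr (e3.trans_lt h)
    have b1 := int_of_bounds hk' (-1) (by push_cast; linarith) (by push_cast; linarith)
    have b2 := int_of_bounds hl' (-1) (by push_cast; linarith) (by push_cast; linarith)
    push_cast at b1 b2
    linarith

/-- Umlaufsatz, extreme vertex at index 0. -/
lemma SP.umlauf0 (h : SP d z) (he : ExtV d z 0) {s : ℝ} (hs : s = 1 ∨ s = -1)
    (hc : 0 < s * cr (z 1 - z 0) (z (d - 1) - z 0)) : turn d z = 2 * Real.pi * s := by
  obtain ⟨n, rfl⟩ : ∃ n, d = n + 3 := ⟨d - 3, by have := h.three; omega⟩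
  have hz : z (n+3) = z 0 := by have := h.per 0; rwa [zero_add] at this
  have hz1 : z (n+4) = z 1 := by have := h.per 1; rwa [show 1 + (n+3) = n + 4 by ring] at this
  obtain ⟨ω, hω, H⟩ := he
  have t1 : ∀ j, j < n + 1 → ((z (j+2) - z 0) / (z (j+1) - z 0)).arg =
      (ω * (z (j+1+1) - z 0)).arg - (ω * (z (j+1) - z 0)).arg := by
    intro j hj
    exact arg_div_lpos hω (H _ (by omega) (by omega)) (H _ (by omega) (by omega))
  have t2 : ∀ j, j < n + 1 → ((z 0 - z (j+2)) / (z 0 - z (j+1))).arg =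
      (ω * (z (j+1+1) - z 0)).arg - (ω * (z (j+1) - z 0)).arg := by
    intro j hj
    rw [← t1 j hj, ← neg_sub (z (j+2)), ← neg_sub (z (j+1)), neg_div_neg_eq]
  unfold turn
  rw [Finset.sum_range_succ, h.path2, Finset.sum_congr rfl (fun j hj => t1 j (Finset.mem_range.1 hj)),
    Finset.sum_congr rfl (fun j hj => t2 j (Finset.mem_range.1 hj)),
    Finset.sum_range_sub (fun j => (ω * (z (j+1) - z 0)).arg)]
  have := arg_div_lpos hω (H 1 (by omega) (by omega)) (H (n+2) (by omega) (by omega))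
  rw [show n + 3 - 1 = n + 2 by omega] at hc
  have X := six hs hc
  simp only [add_assoc, Nat.reduceAdd, zero_add] at *
  rw [hz, hz1, ← this]
  rw [neg_sub, neg_sub, sub_sub_sub_cancel_right] at X
  linarith

end

section
variable {d : ℕ} {z : ℕ → ℂ}

lemma SP.vne (h : SP d z) {i j : ℕ} (hij : i < j) (hj : j < d) : z i ≠ z j := by
  intro e
  rcases h.inter i j hij hj (z i) (left_mem_segment _ _ _) (by rw [e]; exact left_mem_segment _ _ _) with ⟨h1, _⟩ | ⟨h1, h2, _⟩
  · exact h.ne i (by omega) (by rw [← h1]; exact e)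
  · apply h.ne j hj
    have := h.per 0
    rw [h2, ← e, h1]; simpa using this.symm

lemma SP.vne' (h : SP d z) {i j : ℕ} (hij : i ≠ j) (hi : i < d) (hj : j < d) : z i ≠ z j := by
  rcases lt_or_gt_of_ne hij with h1 | h1
  · exact h.vne h1 hj
  · exact (h.vne h1 hi).symm

lemma SP.rot1 (h : SP d z) : SP d (fun k => z (k + 1)) := by
  have h3 := h.three
  have hd : z d = z 0 := by have := h.per 0; rwa [zero_add] at this
  have hd1 : z (d + 1) = z 1 := by have := h.per 1; rwa [add_comm] at this
  refine ⟨h3, fun k => ?_, fun k hk => ?_, fun i j hij hj x hx hy => ?_⟩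
  · show z (k + d + 1) = z (k + 1)
    rw [← h.per (k+1)]; congr 1; omega
  · show z (k + 1) ≠ z (k + 1 + 1)
    by_cases hk' : k + 1 < d
    · exact h.ne _ hk'
    · have : k + 1 = d := by omega
      rw [this, hd, hd1]; exact h.ne 0 (by omega)
  · by_cases hj' : j + 1 < d
    · rcases h.inter (i+1) (j+1) (by omega) hj' x hx hy with h1 | h1
      · left; exact ⟨by omega, h1.2⟩
      · omega
    · have e : j + 1 = d := by omega
      rw [e, hd, hd1] at hy
      rcases h.inter 0 (i+1) (by omega) (by omega) x hy hx with h1 | h1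
      · right; exact ⟨by omega, by omega, by rw [h1.2, h1.1]⟩
      · left; refine ⟨by omega, ?_⟩
        rw [e, hd]; exact h1.2.2

lemma SP.rot (h : SP d z) (r : ℕ) : SP d (fun k => z (k + r)) := by
  induction r with
  | zero => exact h
  | succ r ih =>
    have := ih.rot1
    convert this using 3
    omega

lemma turn_rot (h : SP d z) (r : ℕ) : turn d (fun k => z (k + r)) = turn d z := by
  induction r with
  | zero => rfl
  | succ r ih =>
    rw [← ih]
    have hr := h.rot r
    have p0 := hr.per 0
    have p1 := hr.per 1
    have p2 := hr.per 2
    unfold turn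
    have e1 := Finset.sum_range_succ (fun k => ((z (k + 2 + r) - z (k + 1 + r)) / (z (k + 1 + r) - z (k + r))).arg) d
    have e2 := Finset.sum_range_succ' (fun k => ((z (k + 2 + r) - z (k + 1 + r)) / (z (k + 1 + r) - z (k + r))).arg) d
    have e3 : ((z (d + 2 + r) - z (d + 1 + r)) / (z (d + 1 + r) - z (d + r))).arg = ((z (0 + 2 + r) - z (0 + 1 + r)) / (z (0 + 1 + r) - z (0 + r))).arg := by
      rw [show d + 2 + r = 2 + d + r by ring, show d + 1 + r = 1 + d + r by ring, p1, p2, 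
        show d + r = 0 + d + r by ring, p0]
    rw [e1, e3] at e2
    have := add_right_cancel e2
    rw [this]
    apply Finset.sum_congr rfl
    intro k _
    rw [show k + 1 + 2 + r = k + 2 + (r + 1) by ring, show k + 1 + 1 + r = k + 1 + (r+1) by ring, show k + 1 + r = k + (r+1) by ring]

lemma ext_rot (h : SP d z) {k : ℕ} (hk : k < d) (he : ExtV d z k) : ExtV d (fun j => z (j + k)) 0 := by
  obtain ⟨ω, hω, H⟩ := he
  refine ⟨ω, hω, fun j hj hj0 => ?_⟩
  simp only [zero_add]
  by_cases hjk : j + k < d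
  · exact H _ hjk (by omega)
  · have : z (j + k) = z (j + k - d) := by
      rw [← h.per (j + k - d)]; congr 1; omega
    rw [this]
    exact H _ (by omega) (by omega)

lemma SP.umlauf (h : SP d z) {k : ℕ} (hk : k < d) (he : ExtV d z k) {s : ℝ} (hs : s = 1 ∨ s = -1)
    (hc : 0 < s * cr (z (k + 1) - z k) (z (k + d - 1) - z k)) : turn d z = 2 * Real.pi * s := by
  rw [← turn_rot h k]
  have h3 := h.three
  apply (h.rot k).umlauf0 (ext_rot h hk he) hs
  simp only [zero_add]
  rwa [add_comm 1 k, show d - 1 + k = k + d - 1 by omega]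

lemma SP.exists_ext (h : SP d z) {ω : ℂ} (hω : ω ≠ 0) :
    ∃ k, k < d ∧ ∀ j, j < d → j ≠ k → lpos (ω * (z j - z k)) := by
  have h3 := h.three
  obtain ⟨k, hk, H⟩ := Finset.exists_min_image (Finset.range d) (fun j => toLex ((ω * z j).re, (ω * z j).im))
    ⟨0, Finset.mem_range.2 (by omega)⟩
  refine ⟨k, Finset.mem_range.1 hk, fun j hj hjk => ?_⟩
  have h1 := H j (Finset.mem_range.2 hj)
  rw [Prod.Lex.toLex_le_toLex] at h1
  have h2 : ω * z j ≠ ω * z k := fun e => h.vne' hjk hj (Finset.mem_range.1 hk) (mul_left_cancel₀ hω e)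
  rw [mul_sub]
  unfold lpos
  simp only [Complex.sub_re, Complex.sub_im] at *
  rcases h1 with h1 | ⟨h1, h1'⟩
  · left; linarith
  · right
    refine ⟨by linarith, ?_⟩
    rcases h1'.lt_or_eq with h4 | h4
    · linarith
    · exact absurd (Complex.ext h1.symm h4.symm) h2

lemma SP.cr_ne0 (h : SP d z) (he : ExtV d z 0) : cr (z 1 - z 0) (z (d - 1) - z 0) ≠ 0 := by
  have h3 := h.three
  have hd : z d = z 0 := by have := h.per 0; rwa [zero_add] at this
  obtain ⟨ω, hω, H⟩ := he
  have hw := H 1 (by omega) (by omega)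
  have hu := H (d-1) (by omega) (by omega)
  set w := z 1 - z 0 with hwd
  set u := z (d-1) - z 0 with hud
  intro h0
  have hw0 : w ≠ 0 := by rintro e; rw [e] at hw; simp [lpos] at hw
  have hu0 : u ≠ 0 := by rintro e; rw [e] at hu; simp [lpos] at hu
  have him : (u / w).im = 0 := by rw [div_im_cr, h0, zero_div]
  obtain ⟨c, hc⟩ : ∃ c : ℝ, u = c • w := by
    refine ⟨(u / w).re, ?_⟩
    have : (((u / w).re : ℝ) : ℂ) = u / w := by apply Complex.ext <;> simp [him]
    rw [Complex.real_smul, this, div_mul_cancel₀ _ hw0]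
  have hcpos : 0 < c := by
    by_contra hneg
    push Not at hneg
    have : ω * u = c • (ω * w) := by rw [hc, mul_smul_comm]
    rw [this] at hu
    unfold lpos at hu hw
    simp at hu hw
    rcases hu with hu | hu <;> rcases hw with hw | hw
    · nlinarith
    · rw [hw.1] at hu; simp at hu
    · rcases hu.1 with h1 | h1
      · rw [h1] at hu; simp at hu
      · linarith
    · nlinarith [hu.2, hw.2]
  -- overlap
  have hx := h.inter 0 (d-1) (by omega) (by omega)
  rw [show d - 1 + 1 = d by omega, hd] at hx
  by_cases hc1 : c ≤ 1
  · have := hx (z 0 + u) ⟨1 - c, c, by linarith, hcpos.le, by ring, by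
      rw [hc, hwd]; simp; ring⟩ ⟨1, 0, by norm_num, le_rfl, by ring, by rw [hud]; simp⟩
    rcases this with h1 | h1
    · omega
    · apply hu0; linear_combination h1.2.2
  · push Not at hc1
    have := hx (z 0 + w) ⟨0, 1, by norm_num, by norm_num, by ring, by
      rw [hwd]; simp⟩ ⟨1/c, 1 - 1/c, by positivity, by
        rw [sub_nonneg, div_le_one hcpos]; exact hc1.le, by ring, by
        have e : w = (1/c) • u := by rw [hc, smul_smul]; simp [hcpos.ne']
        rw [e, hud]; simp; ring⟩
    rcases this with h1 | h1
    · omega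
    · apply hw0; linear_combination h1.2.2

def sub' {X : Type} (j : ℕ) (z : ℕ → X) : ℕ → X := fun k => z (k % (j + 1))

lemma SP.sub (h : SP d z) {j : ℕ} (h2 : 2 ≤ j) (hj : j + 2 ≤ d)
    (hd : ∀ k, k < d → ∀ x, x ∈ segment ℝ (z k) (z (k+1)) → x ∈ segment ℝ (z 0) (z j) → x = z 0 ∨ x = z j) :
    SP (j + 1) (sub' j z) := by
  have e1 : ∀ k, k ≤ j → sub' j z k = z k := fun k hk => by
    unfold sub'; rw [Nat.mod_eq_of_lt (by omega)]
  have e2 : sub' j z (j + 1) = z 0 := by unfold sub'; simp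
  have h0 : ∀ i, i < j → z 0 ∈ segment ℝ (z i) (z (i+1)) → i = 0 := by
    intro i hi hx
    by_contra hi0
    rcases h.inter 0 i (by omega) (by omega) (z 0) (left_mem_segment _ _ _) hx with h1 | h1
    · exact h.vne (by omega : 0 < i) (by omega) h1.2
    · omega
  have hj' : ∀ i, i < j → z j ∈ segment ℝ (z i) (z (i+1)) → j = i + 1 := by
    intro i hi hx
    rcases h.inter i j hi (by omega) (z j) hx (left_mem_segment _ _ _) with h1 | h1
    · exact h1.1
    · omega
  refine ⟨by omega, fun k => by unfold sub'; simp, fun k hk => ?_, fun i i' hi hi' x hx hy => ?_⟩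
  · by_cases hkj : k < j
    · rw [e1 k (by omega), e1 (k+1) (by omega)]; exact h.ne k (by omega)
    · obtain rfl : k = j := by omega
      rw [e1 k le_rfl, e2]; exact (h.vne (by omega : 0 < k) (by omega)).symm
  · rw [e1 i (by omega), e1 (i+1) (by omega)] at hx
    by_cases hkj : i' < j
    · rw [e1 i' (by omega), e1 (i'+1) (by omega)] at hy
      rcases h.inter i i' hi (by omega) x hx hy with h1 | h1
      · left; rw [e1 i' (by omega)]; exact h1
      · omega
    · obtain rfl : i' = j := by omega
      rw [e1 i' le_rfl, e2, segment_symm] at hy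
      rw [e1 i' le_rfl, e1 0 (by omega)]
      rcases hd i (by omega) x hx hy with rfl | rfl
      · right; exact ⟨h0 i hi hx, rfl, rfl⟩
      · left; exact ⟨hj' i hi hx, rfl⟩

lemma core {a0 b0 a1 b1 : ℝ} (h1 : 0 ≤ a1) (h2 : 0 ≤ b1) (h : a0 < 0 ∨ b0 < 0) :
    ∃ t : ℝ, 0 ≤ t ∧ t ≤ 1 ∧ (((1 - t) * a0 + t * a1 = 0 ∧ 0 ≤ (1 - t) * b0 + t * b1) ∨
      ((1 - t) * b0 + t * b1 = 0 ∧ 0 ≤ (1 - t) * a0 + t * a1)) := by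
  have key : ∀ a0 b0 a1 b1 : ℝ, 0 ≤ a1 → 0 ≤ b1 → a0 < 0 → 0 ≤ b0 →
      ∃ t : ℝ, 0 ≤ t ∧ t ≤ 1 ∧ ((1 - t) * a0 + t * a1 = 0 ∧ 0 ≤ (1 - t) * b0 + t * b1) := by
    intro a0 b0 a1 b1 h1 h2 h3 h4
    have hp : 0 < a1 - a0 := by linarith
    have t0 : 0 ≤ -a0 / (a1 - a0) := div_nonneg (by linarith) hp.le
    have t1 : -a0 / (a1 - a0) ≤ 1 := by rw [div_le_one hp]; linarith
    refine ⟨-a0 / (a1 - a0), t0, t1, ?_, ?_⟩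
    · field_simp; ring
    · have := mul_nonneg (sub_nonneg.2 t1) h4
      have := mul_nonneg t0 h2
      linarith
  have key2 : ∀ a0 b0 a1 b1 : ℝ, 0 ≤ a1 → 0 ≤ b1 → a0 < 0 → b0 < 0 → a0 * b1 ≤ b0 * a1 →
      ∃ t : ℝ, 0 ≤ t ∧ t ≤ 1 ∧ ((1 - t) * a0 + t * a1 = 0 ∧ 0 ≤ (1 - t) * b0 + t * b1) := by
    intro a0 b0 a1 b1 h1 h2 h3 h4 h5
    have hp : 0 < a1 - a0 := by linarith
    have t0 : 0 ≤ -a0 / (a1 - a0) := div_nonneg (by linarith) hp.le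
    have t1 : -a0 / (a1 - a0) ≤ 1 := by rw [div_le_one hp]; linarith
    refine ⟨-a0 / (a1 - a0), t0, t1, ?_, ?_⟩
    · field_simp; ring
    · have : (1 - -a0 / (a1 - a0)) * b0 + -a0 / (a1 - a0) * b1 = (b0 * a1 - a0 * b1) / (a1 - a0) := by
        field_simp; ring
      rw [this]; exact div_nonneg (by linarith) hp.le
  by_cases ha : a0 < 0
  · by_cases hb : b0 < 0
    · rcases le_total (a0 * b1) (b0 * a1) with h5 | h5
      · obtain ⟨t, x, y, w⟩ := key2 a0 b0 a1 b1 h1 h2 ha hb h5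
        exact ⟨t, x, y, Or.inl w⟩
      · obtain ⟨t, x, y, w⟩ := key2 b0 a0 b1 a1 h2 h1 hb ha h5
        exact ⟨t, x, y, Or.inr w⟩
    · obtain ⟨t, x, y, w⟩ := key a0 b0 a1 b1 h1 h2 ha (not_lt.1 hb)
      exact ⟨t, x, y, Or.inl w⟩
  · have hb : b0 < 0 := h.resolve_left ha
    obtain ⟨t, x, y, w⟩ := key b0 a0 b1 a1 h2 h1 hb (not_lt.1 ha)
    exact ⟨t, x, y, Or.inr w⟩

def Aff (f : ℂ → ℝ) : Prop := ∀ x y : ℂ, ∀ s t : ℝ, s + t = 1 → f (s • x + t • y) = s * f x + t * f y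

lemma coords (v w u : ℂ) (h : cr (w - v) (u - v) ≠ 0) : ∃ α β : ℂ → ℝ, Aff α ∧ Aff β ∧
    (∀ x, x = v + α x • (w - v) + β x • (u - v)) ∧ α v = 0 ∧ β v = 0 ∧ α w = 1 ∧ β w = 0 ∧ α u = 0 ∧ β u = 1 ∧
    ∃ p q : ℂ, (∀ x y, α x - α y = (p * x).re - (p * y).re) ∧ (∀ x y, β x - β y = (q * x).re - (q * y).re) := by
  refine ⟨fun x => cr (x - v) (u - v) / cr (w - v) (u - v), fun x => cr (w - v) (x - v) / cr (w - v) (u - v), 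
    ?_, ?_, ?_, ?_, ?_, ?_, ?_, ?_, ?_, ⟨(u - v).im / cr (w - v) (u - v), (u - v).re / cr (w - v) (u - v)⟩,
    ⟨-(w - v).im / cr (w - v) (u - v), -(w - v).re / cr (w - v) (u - v)⟩, ?_, ?_⟩
  · intro x y s t hst
    obtain rfl : s = 1 - t := by linarith
    field_simp
    simp [cr]; ring
  · intro x y s t hst
    obtain rfl : s = 1 - t := by linarith
    field_simp
    simp [cr]; ring
  · intro x
    apply Complex.ext
    · simp; field_simp; simp [cr]; ring
    · simp; field_simp; simp [cr]; ring
  · simp [cr]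
  · simp [cr]
  · simp [h]
  · simp only [div_eq_zero_iff]; left; simp [cr]; ring
  · simp only [div_eq_zero_iff]; left; simp [cr]; ring
  · simp [h]
  · intro x y
    simp; field_simp; simp [cr]; ring
  · intro x y
    simp; field_simp; simp [cr]; ring

end

section
variable {d : ℕ} {z : ℕ → ℂ}

lemma SP.diag (h : SP d z) (h4 : 4 ≤ d) (hc : cr (z 1 - z 0) (z (d-1) - z 0) ≠ 0) :
    (∃ j, 2 ≤ j ∧ j + 2 ≤ d ∧ (∃ a b : ℝ, 0 < a ∧ 0 < b ∧ z j - z 0 = a • (z 1 - z 0) + b • (z (d-1) - z 0)) ∧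
      ∀ k, k < d → ∀ x, x ∈ segment ℝ (z k) (z (k+1)) → x ∈ segment ℝ (z 0) (z j) → x = z 0 ∨ x = z j) ∨
    ((∀ k, k < d → ∀ x, x ∈ segment ℝ (z k) (z (k+1)) → x ∈ segment ℝ (z (d-1)) (z 1) → x = z (d-1) ∨ x = z 1) ∧
      ∃ ω : ℂ, ω ≠ 0 ∧ (ω * z 2).re < (ω * z 0).re ∧ (ω * z 2).re < (ω * z 1).re ∧ (ω * z 2).re < (ω * z (d-1)).re) := by
  have hd : z d = z 0 := by have := h.per 0; rwa [zero_add] at this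
  obtain ⟨α, β, hα, hβ, hx, αv, βv, αw, βw, αu, βu, p, q, hp, hq⟩ := coords (z 0) (z 1) (z (d-1)) hc
  -- points on the two sides at z 0
  have on0 : ∀ y, β y = 0 → 0 ≤ α y → α y ≤ 1 → y ∈ segment ℝ (z 0) (z 1) := by
    intro y h1 h2 h3
    refine ⟨1 - α y, α y, by linarith, h2, by ring, ?_⟩
    conv_rhs => rw [hx y, h1]
    simp; ring
  have on1 : ∀ y, α y = 0 → 0 ≤ β y → β y ≤ 1 → y ∈ segment ℝ (z (d-1)) (z (d - 1 + 1)) := by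
    intro y h1 h2 h3
    rw [show d - 1 + 1 = d by omega, hd]
    refine ⟨β y, 1 - β y, h2, by linarith, by ring, ?_⟩
    conv_rhs => rw [hx y, h1]
    simp; ring
  have inj : ∀ x y, α x = α y → β x = β y → x = y := by
    intro x y h1 h2
    rw [hx x, hx y, h1, h2]
  -- core step: endpoint e of side k, x in side k
  have step : ∀ k e x, 1 ≤ k → k + 2 ≤ d → e ∈ segment ℝ (z k) (z (k+1)) → x ∈ segment ℝ (z k) (z (k+1)) →
      0 ≤ α x → 0 ≤ β x → (α e < 0 ∨ β e < 0) → α e + β e ≤ 1 → α x + β x ≤ 1 →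
      ∃ t : ℝ, 0 ≤ t ∧ t ≤ 1 ∧ (((1 - t) • e + t • x = z 1 ∧ k = 1) ∨ ((1 - t) • e + t • x = z (d-1) ∧ k + 2 = d)) := by
    intro k e x hk hk' he hxs h1 h2 h3 h5 h6
    obtain ⟨t, t0, t1, H⟩ := core h1 h2 h3
    refine ⟨t, t0, t1, ?_⟩
    have eα := hα e x (1 - t) t (by ring)
    have eβ := hβ e x (1 - t) t (by ring)
    have hl : ((1 - t) * α e + t * α x) + ((1 - t) * β e + t * β x) ≤ 1 := by
      have := mul_le_mul_of_nonneg_left h5 (sub_nonneg.2 t1)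
      have := mul_le_mul_of_nonneg_left h6 t0
      linarith
    have hy : (1 - t) • e + t • x ∈ segment ℝ (z k) (z (k+1)) :=
      convex_segment (z k) (z (k+1)) he hxs (by linarith) t0 (by ring)
    rw [← eα, ← eβ] at H hl
    set y := (1 - t) • e + t • x
    rcases H with ⟨H1, H2⟩ | ⟨H1, H2⟩
    · right
      rcases h.inter k (d-1) (by omega) (by omega) y hy (on1 y H1 H2 (by linarith)) with g | g
      · exact ⟨g.2, by omega⟩
      · omega
    · left
      rcases h.inter 0 k (by omega) (by omega) y (on0 y H1 H2 (by linarith)) hy with g | g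
      · have : k = 1 := by omega
        subst this
        exact ⟨g.2, rfl⟩
      · omega
  by_cases hK : ∃ k, 2 ≤ k ∧ k + 2 ≤ d ∧ 0 ≤ α (z k) ∧ 0 ≤ β (z k) ∧ α (z k) + β (z k) ≤ 1
  · left
    classical
    obtain ⟨j, hj, hmin⟩ := Finset.exists_min_image ((Finset.range d).filter
      (fun k => 2 ≤ k ∧ k + 2 ≤ d ∧ 0 ≤ α (z k) ∧ 0 ≤ β (z k) ∧ α (z k) + β (z k) ≤ 1)) (fun k => α (z k) + β (z k)) (by
        obtain ⟨k, hk⟩ := hK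
        exact ⟨k, Finset.mem_filter.2 ⟨Finset.mem_range.2 (by omega), hk⟩⟩)
    obtain ⟨-, hj2, hjd, ja, jb, jl⟩ := Finset.mem_filter.1 hj
    have ja' : 0 < α (z j) := by
      rcases ja.lt_or_eq with g | g
      · exact g
      · exfalso
        rcases h.inter j (d-1) (by omega) (by omega) (z j) (left_mem_segment _ _ _) (on1 _ g.symm jb (by linarith)) with g | g
        · exact h.vne (by omega : j < d - 1) (by omega) g.2
        · omega
    have jb' : 0 < β (z j) := by
      rcases jb.lt_or_eq with g | g
      · exact g
      · exfalso
        rcases h.inter 0 j (by omega) (by omega) (z j) (on0 _ g.symm ja (by linarith)) (left_mem_segment _ _ _) with g | g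
        · omega
        · omega
    refine ⟨j, hj2, hjd, ⟨α (z j), β (z j), ja', jb', ?_⟩, ?_⟩
    · conv_lhs => rw [hx (z j)]
      ring
    intro k hk x hxk hxd
    obtain ⟨s, t, hs, ht, hst, rfl⟩ := hxd
    have eα := hα (z 0) (z j) s t hst
    have eβ := hβ (z 0) (z j) s t hst
    rw [αv, mul_zero, zero_add] at eα
    rw [βv, mul_zero, zero_add] at eβ
    by_cases hs0 : s = 0
    · right
      have : t = 1 := by linarith
      subst hs0; subst this; simp
    have hspos : 0 < s := lt_of_le_of_ne hs (Ne.symm hs0)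
    left
    have hxa : 0 ≤ α (s • z 0 + t • z j) := by rw [eα]; positivity
    have hxb : 0 ≤ β (s • z 0 + t • z j) := by rw [eβ]; positivity
    have hxl : α (s • z 0 + t • z j) + β (s • z 0 + t • z j) < α (z j) + β (z j) := by
      rw [eα, eβ]
      have : t < 1 := by linarith
      nlinarith
    set x := s • z 0 + t • z j with hxdef
    by_cases hk0 : k = 0
    · subst hk0
      obtain ⟨a, b, _, _, hab, e⟩ := hxk
      have := hβ (z 0) (z 1) a b hab
      rw [zero_add] at e
      rw [e, βv, βw, eβ] at this
      have ht0 : t = 0 := by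
        have : t * β (z j) = 0 := by linarith
        exact (mul_eq_zero.1 this).resolve_right jb'.ne'
      have : s = 1 := by linarith
      rw [hxdef, ht0, this]; simp
    by_cases hk1 : k + 1 = d
    · rw [hk1, hd, show k = d - 1 by omega] at hxk
      obtain ⟨a, b, _, _, hab, e⟩ := hxk
      have := hα (z (d-1)) (z 0) a b hab
      rw [e, αv, αu, eα] at this
      have ht0 : t = 0 := by
        have : t * α (z j) = 0 := by linarith
        exact (mul_eq_zero.1 this).resolve_right ja'.ne'
      have : s = 1 := by linarith
      rw [hxdef, ht0, this]; simp
    exfalso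
    -- find endpoint with small level
    have bad : ∀ m, 1 ≤ m → m + 1 ≤ d → z m ∈ segment ℝ (z k) (z (k+1)) → α (z m) + β (z m) < α (z j) + β (z j) → False := by
      intro m hm hm' hmk hl
      have hneg : α (z m) < 0 ∨ β (z m) < 0 := by
        by_contra hcon
        push Not at hcon
        have hm1 : m ≠ 1 := by rintro rfl; rw [αw, βw] at hl; linarith
        have hmd : m ≠ d - 1 := by rintro rfl; rw [αu, βu] at hl; linarith
        have := hmin m (Finset.mem_filter.2 ⟨Finset.mem_range.2 (by omega), by omega, by omega, hcon.1, hcon.2, by linarith⟩)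
        linarith
      obtain ⟨τ, τ0, τ1, H⟩ := step k (z m) x (by omega) (by omega) hmk hxk hxa hxb hneg (by linarith) (by linarith)
      have e1 := hα (z m) x (1 - τ) τ (by ring)
      have e2 := hβ (z m) x (1 - τ) τ (by ring)
      have e3 : (1 - τ) * (α (z m) + β (z m)) + τ * (α x + β x) < 1 := by
        rcases τ0.lt_or_eq with g | g
        · have := mul_lt_mul_of_pos_left (hxl.trans_le jl) g
          have := mul_le_mul_of_nonneg_left (hl.le.trans jl) (sub_nonneg.2 τ1)
          linarith
        · rw [← g]; linarith
      rcases H with ⟨H, _⟩ | ⟨H, _⟩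
      · rw [H, αw] at e1; rw [H, βw] at e2; linarith
      · rw [H, αu] at e1; rw [H, βu] at e2; linarith
    have g1 : α (z j) + β (z j) ≤ α (z k) + β (z k) := by
      by_contra hcon
      exact bad k (by omega) (by omega) (left_mem_segment _ _ _) (not_le.1 hcon)
    have g2 : α (z j) + β (z j) ≤ α (z (k+1)) + β (z (k+1)) := by
      by_contra hcon
      exact bad (k+1) (by omega) (by omega) (right_mem_segment _ _ _) (not_le.1 hcon)
    obtain ⟨a, b, ha, hb, hab, e⟩ := hxk
    have f1 := hα (z k) (z (k+1)) a b hab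
    have f2 := hβ (z k) (z (k+1)) a b hab
    rw [e] at f1 f2
    have := mul_le_mul_of_nonneg_left g1 ha
    have := mul_le_mul_of_nonneg_left g2 hb
    have hb1 : b = 1 - a := by linarith
    subst hb1
    linarith
  · right
    push Not at hK
    refine ⟨?_, ?_⟩
    · intro k hk x hxk hxd
      obtain ⟨s, t, hs, ht, hst, hxe⟩ := hxd
      have eα := hα (z (d-1)) (z 1) s t hst
      have eβ := hβ (z (d-1)) (z 1) s t hst
      rw [hxe, αu, αw] at eα
      rw [hxe, βu, βw] at eβ
      have hxl : α x + β x = 1 := by linarith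
      by_contra hcon
      push Not at hcon
      obtain ⟨xu, xw⟩ := hcon
      by_cases hk0 : k = 0
      · subst hk0
        obtain ⟨a, b, _, _, hab, e⟩ := hxk
        have := hβ (z 0) (z 1) a b hab
        rw [zero_add] at e
        rw [e, βv, βw] at this
        apply xw
        apply inj
        · rw [αw]; linarith
        · rw [βw]; linarith
      by_cases hk1 : k + 1 = d
      · rw [hk1, hd, show k = d - 1 by omega] at hxk
        obtain ⟨a, b, _, _, hab, e⟩ := hxk
        have := hα (z (d-1)) (z 0) a b hab
        rw [e, αv, αu] at this
        apply xu
        apply inj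
        · rw [αu]; linarith
        · rw [βu]; linarith
      -- interior endpoints have level > 1
      have big : ∀ m, 2 ≤ m → m + 2 ≤ d → (m = k ∨ m = k + 1) → 1 < α (z m) + β (z m) := by
        intro m hm hm' hmk
        by_contra hcon
        push Not at hcon
        have hneg : α (z m) < 0 ∨ β (z m) < 0 := by
          by_contra hcon'
          push Not at hcon'
          have := hK m hm hm' hcon'.1 hcon'.2
          linarith
        have hmseg : z m ∈ segment ℝ (z k) (z (k+1)) := by
          rcases hmk with rfl | rfl
          · exact left_mem_segment _ _ _
          · exact right_mem_segment _ _ _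
        obtain ⟨τ, τ0, τ1, H⟩ := step k (z m) x (by omega) (by omega) hmseg hxk (by linarith) (by linarith) hneg hcon hxl.le
        -- y = endpoint f of side k other than z m
        have fin : ∀ f : ℂ, f ≠ z m → x ∈ segment ℝ f (z m) → (1 - τ) • z m + τ • x = f → x = f := by
          intro f hf hxf hy
          obtain ⟨a, b, ha, hb, hab, rfl⟩ := hxf
          have e : (1 - τ + τ * b) • (z m - f) = 0 := by
            have ha' : a = 1 - b := by linarith
            subst ha'
            have : (1 - τ + τ * b) • (z m - f) = (1 - τ) • z m + τ • ((1 - b) • f + b • z m) - f := by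
              simp; ring
            rw [this, hy, sub_self]
          have e2 : 1 - τ + τ * b = 0 := (smul_eq_zero.1 e).resolve_right (sub_ne_zero.2 hf.symm)
          have e3 : 0 ≤ τ * b := mul_nonneg τ0 hb
          have e4 : τ = 1 := by linarith
          subst e4
          have : b = 0 := by linarith
          subst this
          have : a = 1 := by linarith
          subst this
          simp
        rcases H with ⟨H, Hk⟩ | ⟨H, Hk⟩
        · subst Hk
          obtain rfl : m = 2 := by omega
          exact xw (fin (z 1) (h.vne (by omega) (by omega)) hxk H)
        · obtain rfl : m = k := by omega
          rw [show m + 1 = d - 1 by omega, segment_symm] at hxk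
          exact xu (fin (z (d-1)) (h.vne (by omega) (by omega)).symm hxk H)
      obtain ⟨a, b, ha, hb, hab, e⟩ := hxk
      have f1 := hα (z k) (z (k+1)) a b hab
      have f2 := hβ (z k) (z (k+1)) a b hab
      rw [e] at f1 f2
      have hb1 : b = 1 - a := by linarith
      subst hb1
      by_cases hk1' : k = 1
      · subst hk1'
        have g := big 2 le_rfl (by omega) (Or.inr rfl)
        simp only [Nat.reduceAdd] at *
        rw [αw] at f1; rw [βw] at f2
        have : (1 - a) * (α (z 2) + β (z 2) - 1) = 0 := by linarith
        have ha1 : 1 - a = 0 := (mul_eq_zero.1 this).resolve_right (by linarith)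
        have : a = 1 := by linarith
        subst this
        apply xw; rw [← e]; simp
      have g := big k (by omega) (by omega) (Or.inl rfl)
      by_cases hk2 : k + 2 = d
      · rw [show k + 1 = d - 1 by omega] at *
        rw [αu] at f1; rw [βu] at f2
        have : a * (α (z k) + β (z k) - 1) = 0 := by linarith
        have ha1 : a = 0 := (mul_eq_zero.1 this).resolve_right (by linarith)
        subst ha1
        apply xu; rw [← e]; simp
      have g' := big (k+1) (by omega) (by omega) (Or.inr rfl)
      rcases ha.lt_or_eq with a0 | a0
      · have := mul_lt_mul_of_pos_left g a0
        have := mul_le_mul_of_nonneg_left g'.le hb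
        linarith
      · rw [← a0] at f1 f2; linarith
    · have h2 := hK 2 le_rfl (by omega)
      have mk : ∀ ω : ℂ, (ω * z 2).re < (ω * z 0).re ∧ (ω * z 2).re < (ω * z 1).re ∧ (ω * z 2).re < (ω * z (d-1)).re →
          ∃ ω : ℂ, ω ≠ 0 ∧ (ω * z 2).re < (ω * z 0).re ∧ (ω * z 2).re < (ω * z 1).re ∧ (ω * z 2).re < (ω * z (d-1)).re := by
        intro ω H
        refine ⟨ω, ?_, H⟩
        rintro rfl
        simp at H
      have p0 := hp (z 2) (z 0)
      have p1 := hp (z 2) (z 1)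
      have p2 := hp (z 2) (z (d-1))
      have q0 := hq (z 2) (z 0)
      have q1 := hq (z 2) (z 1)
      have q2 := hq (z 2) (z (d-1))
      rw [αv] at p0; rw [αw] at p1; rw [αu] at p2
      rw [βv] at q0; rw [βw] at q1; rw [βu] at q2
      by_cases ha : α (z 2) < 0
      · exact mk p ⟨by linarith, by linarith, by linarith⟩
      by_cases hb : β (z 2) < 0
      · exact mk q ⟨by linarith, by linarith, by linarith⟩
      have := h2 (not_lt.1 ha) (not_lt.1 hb)
      apply mk (-(p + q))
      simp only [neg_mul, add_mul, Complex.neg_re, Complex.add_re]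
      exact ⟨by linarith, by linarith, by linarith⟩
end

def Sm (f : ℤ × ℤ → ℤ × ℤ → ℤ) (d : ℕ) (p : ℕ → ℤ × ℤ) : ℤ := ∑ k ∈ Finset.range d, f (p k) (p (k + 1))

def gc (a b : ℤ × ℤ) : ℤ := (Int.gcd (b.1 - a.1) (b.2 - a.2) : ℤ)

lemma toC_inj {p q : ℤ × ℤ} (h : toC p = toC q) : p = q := by
  have h1 := congrArg Complex.re h
  have h2 := congrArg Complex.im h
  simp [toC] at h1 h2
  exact Prod.ext h1 h2

lemma gc_comm (a b : ℤ × ℤ) : gc a b = gc b a := by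
  unfold gc
  rw [← neg_sub b.1, ← neg_sub b.2, Int.gcd_neg, Int.neg_gcd]

lemma gc_pos {a b : ℤ × ℤ} (h : a ≠ b) : 1 ≤ gc a b := by
  unfold gc
  have : Int.gcd (b.1 - a.1) (b.2 - a.2) ≠ 0 := by
    intro h0
    rw [Int.gcd_eq_zero_iff] at h0
    apply h
    apply Prod.ext <;> omega
  omega

lemma Sm_rot (f : ℤ × ℤ → ℤ × ℤ → ℤ) {d : ℕ} {p : ℕ → ℤ × ℤ} (h : ∀ k, p (k + d) = p k) (r : ℕ) :
    Sm f d (fun k => p (k + r)) = Sm f d p := by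
  induction r with
  | zero => rfl
  | succ r ih =>
    rw [← ih]
    unfold Sm
    have e1 := Finset.sum_range_succ (fun k => f (p (k + r)) (p (k + 1 + r))) d
    have e2 := Finset.sum_range_succ' (fun k => f (p (k + r)) (p (k + 1 + r))) d
    have e3 : f (p (d + r)) (p (d + 1 + r)) = f (p (0 + r)) (p (0 + 1 + r)) := by
      rw [show d + r = r + d by ring, show d + 1 + r = 1 + r + d by ring, h, h, zero_add, zero_add]
    rw [e1, e3] at e2
    have := add_right_cancel e2
    rw [this]
    apply Finset.sum_congr rfl
    intro k _
    rw [show k + 1 + 1 + r = k + 1 + (r+1) by ring, show k + 1 + r = k + (r+1) by ring]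

lemma Sm_sub (f : ℤ × ℤ → ℤ × ℤ → ℤ) (j : ℕ) (p : ℕ → ℤ × ℤ) :
    Sm f (j + 1) (sub' j p) = Sm f j p + f (p j) (p 0) := by
  unfold Sm
  rw [Finset.sum_range_succ]
  congr 1
  · apply Finset.sum_congr rfl
    intro k hk
    have := Finset.mem_range.1 hk
    unfold sub'
    rw [Nat.mod_eq_of_lt (by omega), Nat.mod_eq_of_lt (by omega)]
  · unfold sub'
    rw [Nat.mod_eq_of_lt (by omega), Nat.mod_self]

lemma Sm_split (f : ℤ × ℤ → ℤ × ℤ → ℤ) {d j : ℕ} {p : ℕ → ℤ × ℤ} (hj : j ≤ d) (h : p d = p 0) :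
    Sm f (j + 1) (sub' j p) + Sm f (d - j + 1) (sub' (d - j) (fun k => p (k + j))) =
      Sm f d p + f (p j) (p 0) + f (p 0) (p j) := by
  rw [Sm_sub, Sm_sub, Nat.sub_add_cancel hj, h, zero_add]
  have : Sm f d p = Sm f j p + Sm f (d - j) (fun k => p (k + j)) := by
    unfold Sm
    conv_lhs => rw [← Nat.add_sub_cancel' hj, Finset.sum_range_add]
    congr 1
    apply Finset.sum_congr rfl
    intro k _
    rw [add_comm j k, show k + j + 1 = k + 1 + j by ring]
  rw [this]; ring

lemma combine {d j : ℕ} {p : ℕ → ℤ × ℤ} (hj : j ≤ d) (h : p d = p 0) (hne : p 0 ≠ p j) {s : ℤ}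
    (h1 : Sm gc (j + 1) (sub' j p) - 2 ≤ s * Sm det (j + 1) (sub' j p))
    (h2 : Sm gc (d - j + 1) (sub' (d - j) (fun k => p (k + j))) - 2 ≤
      s * Sm det (d - j + 1) (sub' (d - j) (fun k => p (k + j)))) :
    Sm gc d p - 2 ≤ s * Sm det d p := by
  have e1 := Sm_split gc hj h
  have e2 := Sm_split det hj h
  have e3 : det (p j) (p 0) + det (p 0) (p j) = 0 := by unfold det; ring
  rw [gc_comm (p j)] at e1
  have := gc_pos hne
  have e4 : s * Sm det d p = s * (Sm det (j + 1) (sub' j p)) +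
      s * (Sm det (d - j + 1) (sub' (d - j) (fun k => p (k + j)))) := by
    rw [← mul_add, e2, add_assoc, e3, add_zero]
  linarith

lemma num_ineq {a b c D : ℤ} (ha : 1 ≤ a) (hb : 1 ≤ b) (hc : 1 ≤ c) (h1 : a * b ≤ D) (h2 : b * c ≤ D)
    (h3 : c * a ≤ D) : a + b + c - 2 ≤ D := by
  rcases hc.lt_or_eq with h | h
  · rcases le_total a b with g | g <;> nlinarith
  · subst h; nlinarith

lemma gcd_mul_dvd (a b c e : ℤ) : (Int.gcd a b : ℤ) * (Int.gcd c e : ℤ) ∣ a * e - b * c := by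
  apply dvd_sub
  · exact mul_dvd_mul (Int.gcd_dvd_left a b) (Int.gcd_dvd_right c e)
  · exact mul_dvd_mul (Int.gcd_dvd_right a b) (Int.gcd_dvd_left c e)

lemma cr_toC (p q r t : ℤ × ℤ) : cr (toC p - toC q) (toC r - toC t) = (det (p - q) (r - t) : ℤ) := by
  simp [cr, toC, det]

section
variable {d : ℕ}

lemma SP.sign {z : ℕ → ℂ} (h : SP d z) {k : ℕ} (hk : k < d) (he : ExtV d z k) {s : ℝ} (hs : s = 1 ∨ s = -1)
    (ht : turn d z = 2 * Real.pi * s) : 0 < s * cr (z (k + 1) - z k) (z (k + d - 1) - z k) := by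
  have h3 := h.three
  have hp := Real.pi_pos
  have hc := (h.rot k).cr_ne0 (ext_rot h hk he)
  simp only [zero_add] at hc
  rw [add_comm 1 k, show d - 1 + k = k + d - 1 by omega] at hc
  rcases lt_or_gt_of_ne hc with g | g
  · have := h.umlauf hk he (s := -1) (Or.inr rfl) (by linarith)
    rcases hs with rfl | rfl
    · linarith
    · linarith
  · have := h.umlauf hk he (s := 1) (Or.inl rfl) (by linarith)
    rcases hs with rfl | rfl
    · linarith
    · linarith

lemma pick3 {p : ℕ → ℤ × ℤ} (h : SP 3 (fun k => toC (p k))) (s : ℤ) (hs : s = 1 ∨ s = -1)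
    (hc : 0 < s * det (p 1 - p 0) (p 2 - p 0)) : Sm gc 3 p - 2 ≤ s * Sm det 3 p := by
  have h30 : p 3 = p 0 := toC_inj (h.per 0)
  have n0 : p 0 ≠ p 1 := fun e => h.ne 0 (by norm_num) (by simp [e])
  have n1 : p 1 ≠ p 2 := fun e => h.ne 1 (by norm_num) (by simp [e])
  have n2 : p 2 ≠ p 0 := fun e => h.ne 2 (by norm_num) (by simp [e, h30])
  have g0 := gc_pos n0
  have g1 := gc_pos n1
  have g2 := gc_pos n2
  unfold Sm
  simp only [Finset.sum_range_succ, Finset.sum_range_zero, zero_add, Nat.reduceAdd, h30]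
  have eD : det (p 0) (p 1) + det (p 1) (p 2) + det (p 2) (p 0) = det (p 1 - p 0) (p 2 - p 0) := by
    simp [det]; ring
  rw [eD]
  have d1 : gc (p 0) (p 1) * gc (p 1) (p 2) ∣ s * det (p 1 - p 0) (p 2 - p 0) := by
    apply Dvd.dvd.mul_left
    have e : det (p 1 - p 0) (p 2 - p 0) = ((p 1).1 - (p 0).1) * ((p 2).2 - (p 1).2) -
        ((p 1).2 - (p 0).2) * ((p 2).1 - (p 1).1) := by
      simp only [det, Prod.fst_sub, Prod.snd_sub]; ring
    rw [e]; exact gcd_mul_dvd _ _ _ _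
  have d2 : gc (p 1) (p 2) * gc (p 2) (p 0) ∣ s * det (p 1 - p 0) (p 2 - p 0) := by
    apply Dvd.dvd.mul_left
    have e : det (p 1 - p 0) (p 2 - p 0) = ((p 2).1 - (p 1).1) * ((p 0).2 - (p 2).2) -
        ((p 2).2 - (p 1).2) * ((p 0).1 - (p 2).1) := by
      simp only [det, Prod.fst_sub, Prod.snd_sub]; ring
    rw [e]; exact gcd_mul_dvd _ _ _ _
  have d3 : gc (p 2) (p 0) * gc (p 0) (p 1) ∣ s * det (p 1 - p 0) (p 2 - p 0) := by
    apply Dvd.dvd.mul_left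
    have e : det (p 1 - p 0) (p 2 - p 0) = ((p 0).1 - (p 2).1) * ((p 1).2 - (p 0).2) -
        ((p 0).2 - (p 2).2) * ((p 1).1 - (p 0).1) := by
      simp only [det, Prod.fst_sub, Prod.snd_sub]; ring
    rw [e]; exact gcd_mul_dvd _ _ _ _
  exact num_ineq g0 g1 g2 (Int.le_of_dvd hc d1) (Int.le_of_dvd hc d2) (Int.le_of_dvd hc d3)

lemma side_shift {z : ℕ → ℂ} (h : SP d z) {k r : ℕ} (hk : k < d) (hr : r ≤ d) {P : ℂ → Prop}
    (H : ∀ k, k < d → ∀ x, x ∈ segment ℝ (z k) (z (k+1)) → P x) :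
    ∀ x, x ∈ segment ℝ (z (k + r)) (z (k + 1 + r)) → P x := by
  intro x hx
  by_cases hkr : k + r < d
  · exact H (k + r) hkr x (by rwa [show k + r + 1 = k + 1 + r by ring])
  · have e1 : z (k + r) = z (k + r - d) := by rw [← h.per (k + r - d)]; congr 1; omega
    have e2 : z (k + 1 + r) = z (k + r - d + 1) := by rw [← h.per (k + r - d + 1)]; congr 1; omega
    rw [e1, e2] at hx
    exact H _ (by omega) x hx

lemma pick0 {p : ℕ → ℤ × ℤ} (h : SP d (fun k => toC (p k))) (he : ExtV d (fun k => toC (p k)) 0)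
    (IH : ∀ m, m < d → ∀ p : ℕ → ℤ × ℤ, SP m (fun k => toC (p k)) → ∀ s : ℤ, (s = 1 ∨ s = -1) →
      turn m (fun k => toC (p k)) = 2 * Real.pi * s → Sm gc m p - 2 ≤ s * Sm det m p)
    (s : ℤ) (hs : s = 1 ∨ s = -1) (ht : turn d (fun k => toC (p k)) = 2 * Real.pi * s) :
    Sm gc d p - 2 ≤ s * Sm det d p := by
  have h3 := h.three
  have hs' : (s : ℝ) = 1 ∨ (s : ℝ) = -1 := by rcases hs with rfl | rfl <;> simp
  have per : ∀ k, p (k + d) = p k := fun k => toC_inj (h.per k)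
  have hsg := h.sign (by omega) he hs' ht
  simp only [zero_add] at hsg
  by_cases h4 : d = 3
  · subst h4
    apply pick3 h s hs
    rw [cr_toC] at hsg
    exact_mod_cast hsg
  have h4 : 4 ≤ d := by omega
  set z : ℕ → ℂ := fun k => toC (p k) with hz
  have zd : z d = z 0 := by have := h.per 0; rwa [zero_add] at this
  obtain ⟨ω, hω, H⟩ := he
  rcases h.diag h4 (by intro h0; simp only [hz] at h0; rw [h0] at hsg; simp at hsg) with
    ⟨j, hj2, hjd, ⟨a, b, ha, hb, hab⟩, hdiag⟩ | ⟨hdiag, η, hη, η0, η1, η2⟩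
  · have sp1 : SP (j + 1) (sub' j z) := h.sub hj2 hjd hdiag
    have sp2 : SP (d - j + 1) (sub' (d - j) (fun k => z (k + j))) := by
      apply (h.rot j).sub (by omega) (by omega)
      intro k hk x hx hx'
      simp only [zero_add] at hx' ⊢
      rw [Nat.sub_add_cancel (by omega : j ≤ d), zd] at hx' ⊢
      rw [segment_symm] at hx'
      exact (side_shift h hk (by omega : j ≤ d) (P := fun x => x ∈ segment ℝ (z 0) (z j) → x = z 0 ∨ x = z j) hdiag x hx hx').symm
    refine combine (j := j) (by omega) (by simpa using per 0) (fun e => h.vne (by omega : 0 < j) (by omega) (by rw [hz]; simp [e])) ?_ ?_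
    · apply IH (j+1) (by omega) _ sp1 s hs
      have e0 : sub' j z 0 = z 0 := by simp [sub']
      have e1 : sub' j z 1 = z 1 := by unfold sub'; rw [Nat.mod_eq_of_lt (by omega)]
      have e2 : sub' j z (j + 1 - 1) = z j := by unfold sub'; rw [Nat.mod_eq_of_lt (by omega)]; rfl
      apply sp1.umlauf0 ⟨ω, hω, fun m hm hm0 => ?_⟩ hs'
      · rw [e0, e1, e2, hab]
        have : cr (z 1 - z 0) (a • (z 1 - z 0) + b • (z (d-1) - z 0)) = b * cr (z 1 - z 0) (z (d-1) - z 0) := by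
          simp [cr]; ring
        rw [this]
        have := mul_pos hb hsg
        linarith
      · rw [e0]; unfold sub'; rw [Nat.mod_eq_of_lt (by omega)]
        exact H m (by omega) hm0
    · apply IH (d-j+1) (by omega) _ sp2 s hs
      have e0 : sub' (d - j) (fun k => z (k + j)) (d - j) = z 0 := by
        unfold sub'; rw [Nat.mod_eq_of_lt (by omega)]; show z (d - j + j) = z 0
        rw [Nat.sub_add_cancel (by omega), zd]
      have e1 : sub' (d - j) (fun k => z (k + j)) (d - j + 1) = z j := by
        unfold sub'; rw [Nat.mod_self]; show z (0 + j) = z j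
        rw [zero_add]
      have e2 : sub' (d - j) (fun k => z (k + j)) (d - j + (d - j + 1) - 1) = z (d - 1) := by
        unfold sub'
        rw [show d - j + (d - j + 1) - 1 = (d - j - 1) + (d - j + 1) by omega, Nat.add_mod_right, Nat.mod_eq_of_lt (by omega)]
        show z (d - j - 1 + j) = z (d - 1)
        congr 1; omega
      apply sp2.umlauf (k := d - j) (by omega) ⟨ω, hω, fun m hm hm0 => ?_⟩ hs'
      · rw [e0, e1, e2, hab]
        have : cr (a • (z 1 - z 0) + b • (z (d-1) - z 0)) (z (d-1) - z 0) = a * cr (z 1 - z 0) (z (d-1) - z 0) := by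
          simp [cr]; ring
        rw [this]
        have := mul_pos ha hsg
        linarith
      · rw [e0]; unfold sub'; rw [Nat.mod_eq_of_lt (by omega)]
        exact H (m + j) (by omega) (by omega)
  · -- ear at vertex 0
    have hr := h.rot (d - 1)
    have r0 : z (0 + (d - 1)) = z (d - 1) := by rw [zero_add]
    have r1 : z (1 + (d - 1)) = z 0 := by rw [show 1 + (d - 1) = d by omega, zd]
    have r2 : z (2 + (d - 1)) = z 1 := by rw [show 2 + (d - 1) = 1 + d by omega]; exact h.per 1
    have hdiag' : ∀ k, k < d → ∀ x, x ∈ segment ℝ (z (k + (d - 1))) (z (k + 1 + (d - 1))) →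
        x ∈ segment ℝ (z (d-1)) (z 1) → x = z (d-1) ∨ x = z 1 := by
      intro k hk x hx hx'
      exact side_shift h hk (by omega : d - 1 ≤ d) (P := fun x => x ∈ segment ℝ (z (d-1)) (z 1) → x = z (d-1) ∨ x = z 1) hdiag x hx hx'
    have sp1 : SP (2 + 1) (sub' 2 (fun k => z (k + (d - 1)))) := by
      apply hr.sub (by omega) (by omega)
      intro k hk x hx hx'
      simp only [r0, r2] at hx' ⊢
      exact hdiag' k hk x hx hx'
    have r3 : ∀ k, z (k + 2 + (d - 1)) = z (k + 1) := fun k => by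
      rw [show k + 2 + (d - 1) = k + 1 + d by omega]; exact h.per _
    have sp2 : SP (d - 2 + 1) (sub' (d - 2) (fun k => z (k + 2 + (d - 1)))) := by
      apply (hr.rot 2).sub (by omega) (by omega)
      intro k hk x hx hx'
      have r4 : z (d - 2 + 2 + (d - 1)) = z (d - 1) := by rw [r3]; congr 1; omega
      simp only [zero_add, r4, r2] at hx' ⊢
      rw [segment_symm] at hx'
      have := side_shift hr hk (by omega : 2 ≤ d) (P := fun x => x ∈ segment ℝ (z (d-1)) (z 1) → x = z (d-1) ∨ x = z 1) hdiag' x hx hx'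
      exact this.symm
    rw [← Sm_rot gc per (d - 1), ← Sm_rot det per (d - 1)]
    refine combine (j := 2) (by omega) ?_ ?_ ?_ ?_
    · show p (d + (d - 1)) = p (0 + (d - 1))
      rw [zero_add, add_comm, per]
    · intro e
      have e' : z (0 + (d - 1)) = z (2 + (d - 1)) := congrArg toC e
      rw [r0, r2] at e'
      exact h.vne (by omega : 1 < d - 1) (by omega) e'.symm
    · apply IH 3 (by omega) _ sp1 s hs
      have e0 : sub' 2 (fun k => z (k + (d - 1))) 0 = z (d - 1) := r0
      have e1 : sub' 2 (fun k => z (k + (d - 1))) 1 = z 0 := r1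
      have e2 : sub' 2 (fun k => z (k + (d - 1))) 2 = z 1 := r2
      have e3 : sub' 2 (fun k => z (k + (d - 1))) 3 = z (d - 1) := r0
      apply sp1.umlauf (k := 1) (by omega) ⟨ω, hω, fun m hm hm0 => ?_⟩ hs'
      · simp only [Nat.reduceAdd, Nat.reduceSub]
        rw [e1, e2, e3]; exact hsg
      · rw [e1]
        have : m = 0 ∨ m = 2 := by omega
        rcases this with rfl | rfl
        · rw [e0]; exact H _ (by omega) (by omega)
        · rw [e2]; exact H _ (by omega) (by omega)
    · apply IH (d - 2 + 1) (by omega) _ sp2 s hs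
      obtain ⟨k, hk, Hk⟩ := h.exists_ext hη
      have re_le : ∀ j, j < d → (η * z k).re ≤ (η * z j).re := by
        intro j hj
        by_cases hjk : j = k
        · rw [hjk]
        · have := Hk j hj hjk
          rw [mul_sub] at this
          unfold lpos at this
          rw [Complex.sub_re] at this
          rcases this with h | h <;> linarith
      have hk2 := re_le 2 (by omega)
      have k0 : k ≠ 0 := by rintro rfl; linarith
      have k1 : k ≠ 1 := by rintro rfl; linarith
      have kd : k ≠ d - 1 := by rintro rfl; linarith
      have hsk := h.sign hk ⟨η, hη, Hk⟩ hs' ht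
      have ek : z (k + d - 1) = z (k - 1) := by
        rw [show k + d - 1 = k - 1 + d by omega]; exact h.per _
      rw [ek] at hsk
      have e0 : ∀ m, m < d - 1 → sub' (d - 2) (fun k => z (k + 2 + (d - 1))) m = z (m + 1) := by
        intro m hm
        unfold sub'; rw [Nat.mod_eq_of_lt (by omega)]; exact r3 m
      have e1 : sub' (d - 2) (fun k => z (k + 2 + (d - 1))) (k - 1 + (d - 2 + 1) - 1) = z (k - 1) := by
        unfold sub'
        rw [show k - 1 + (d - 2 + 1) - 1 = (k - 2) + (d - 2 + 1) by omega, Nat.add_mod_right, Nat.mod_eq_of_lt (by omega)]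
        show z (k - 2 + 2 + (d - 1)) = z (k - 1)
        rw [r3]; congr 1; omega
      have ekk : k - 1 + 1 = k := by omega
      apply sp2.umlauf (k := k - 1) (by omega) ⟨η, hη, fun m hm hm0 => ?_⟩ hs'
      · rw [e1, e0 _ (by omega), e0 _ (by omega), ekk]; exact hsk
      · rw [e0 m (by omega), e0 _ (by omega), ekk]
        exact Hk _ (by omega) (by omega)

theorem pick (d : ℕ) : ∀ p : ℕ → ℤ × ℤ, SP d (fun k => toC (p k)) → ∀ s : ℤ, (s = 1 ∨ s = -1) →
      turn d (fun k => toC (p k)) = 2 * Real.pi * s → Sm gc d p - 2 ≤ s * Sm det d p := by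
  induction d using Nat.strong_induction_on with
  | _ d IH =>
    intro p h s hs ht
    have per : ∀ k, p (k + d) = p k := fun k => toC_inj (h.per k)
    obtain ⟨k, hk, Hk⟩ := h.exists_ext one_ne_zero
    rw [← Sm_rot gc per k, ← Sm_rot det per k]
    apply pick0 (h.rot k) (ext_rot h hk ⟨1, one_ne_zero, Hk⟩) IH s hs
    rw [← ht]
    exact turn_rot h k

theorem turn_pm {z : ℕ → ℂ} (h : SP d z) : ∃ s : ℤ, (s = 1 ∨ s = -1) ∧ turn d z = 2 * Real.pi * s := by
  obtain ⟨k, hk, Hk⟩ := h.exists_ext one_ne_zero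
  have he := ext_rot h hk ⟨1, one_ne_zero, Hk⟩
  have hc := (h.rot k).cr_ne0 he
  rcases lt_or_gt_of_ne hc with g | g
  · refine ⟨-1, Or.inr rfl, ?_⟩
    rw [← turn_rot h k]
    push_cast
    exact (h.rot k).umlauf0 he (Or.inr rfl) (by linarith)
  · refine ⟨1, Or.inl rfl, ?_⟩
    rw [← turn_rot h k]
    push_cast
    exact (h.rot k).umlauf0 he (Or.inl rfl) (by linarith)
end

lemma seg_CR {p q : ℤ × ℤ} {x : ℂ} (h : x ∈ segment ℝ (toC p) (toC q)) :
    (x.re, x.im) ∈ segment ℝ (toR p) (toR q) := by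
  obtain ⟨a, b, ha, hb, hab, rfl⟩ := h
  exact ⟨a, b, ha, hb, hab, Prod.ext (by simp [toC, toR]) (by simp [toC, toR])⟩

lemma toR_eq {p : ℤ × ℤ} {x : ℂ} (h : (x.re, x.im) = toR p) : x = toC p := by
  have h1 := congrArg Prod.fst h
  have h2 := congrArg Prod.snd h
  exact Complex.ext h1 h2

lemma simple_SP {d : ℕ} [NeZero d] {v : ZMod d → ℤ × ℤ} (h : IsSimplePolygon v) :
    SP d (fun k => toC (v (k : ZMod d))) := by
  obtain ⟨h3, hne, hadj, hdis⟩ := h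
  refine ⟨h3, fun k => by simp, fun k _ e => ?_, fun i j hij hj x hx hy => ?_⟩
  · have := toC_inj e
    push_cast at this
    exact hne _ this
  · have inj : ∀ a b : ℕ, a < d → b < d → ((a : ZMod d) = b) → a = b := by
      intro a b ha hb e
      rw [ZMod.natCast_eq_natCast_iff'] at e
      rwa [Nat.mod_eq_of_lt ha, Nat.mod_eq_of_lt hb] at e
    simp only [Nat.cast_add, Nat.cast_one] at hx hy
    have mx : (x.re, x.im) ∈ side v i := seg_CR hx
    have my : (x.re, x.im) ∈ side v j := seg_CR hy
    by_cases h1 : (j : ZMod d) = i + 1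
    · left
      have e : j = i + 1 := inj _ _ hj (by omega) (by push_cast; exact h1)
      refine ⟨e, ?_⟩
      have hm : (x.re, x.im) ∈ side v i ∩ side v (i + 1) := ⟨mx, by rw [← h1]; exact my⟩
      rw [hadj] at hm
      rw [toR_eq hm, e]; push_cast; rfl
    · by_cases h2 : (i : ZMod d) = j + 1
      · right
        have e : j + 1 = d := by
          by_contra hjd
          have := inj i (j + 1) (by omega) (by omega) (by push_cast; exact h2)
          omega
        have e0 : i = 0 := by
          apply inj i 0 (by omega) (by omega)
          rw [h2]
          have : ((j + 1 : ℕ) : ZMod d) = (d : ℕ) := by rw [e]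
          push_cast at this
          rw [this]; simp
        refine ⟨e0, e, ?_⟩
        have hm : (x.re, x.im) ∈ side v j ∩ side v (j + 1) := ⟨my, by rw [← h2]; exact mx⟩
        rw [hadj, ← h2, e0] at hm
        exact toR_eq hm
      · have hm : (x.re, x.im) ∈ side v i ∩ side v j := ⟨mx, my⟩
        rw [hdis i j (fun e => by have := inj _ _ (by omega) hj e; omega) h1 h2] at hm
        exact hm.elim

lemma sum_ZMod {d : ℕ} [NeZero d] {M : Type} [AddCommMonoid M] (f : ZMod d → M) :
    ∑ i : ZMod d, f i = ∑ k ∈ Finset.range d, f (k : ZMod d) := by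
  symm
  apply Finset.sum_bij (fun (k : ℕ) _ => (k : ZMod d))
  · intros; exact Finset.mem_univ _
  · intro a ha b hb e
    rw [Finset.mem_range] at ha hb
    rw [ZMod.natCast_eq_natCast_iff'] at e
    rwa [Nat.mod_eq_of_lt ha, Nat.mod_eq_of_lt hb] at e
  · intro b _
    exact ⟨b.val, Finset.mem_range.2 (ZMod.val_lt b), by simp⟩
  · intros; rfl

lemma polyB_eq {d : ℕ} [NeZero d] (v : ZMod d → ℤ × ℤ) :
    polyB v (fun _ => 1) = Sm gc d (fun k => v (k : ZMod d)) := by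
  unfold polyB Sm
  rw [sum_ZMod]
  apply Finset.sum_congr rfl
  intro k _
  simp [gc]

lemma polyA_eq2 {d : ℕ} [NeZero d] (v : ZMod d → ℤ × ℤ) :
    polyA v = (Sm det d (fun k => v (k : ZMod d)) : ℤ) / 2 := by
  rw [polyA_eq, sum_ZMod]
  unfold Sm
  push_cast
  congr 1
  apply Finset.sum_congr rfl
  intro k _
  simp [cr, toC, det]

lemma polyC_eq {d : ℕ} [NeZero d] (v : ZMod d → ℤ × ℤ) :
    polyC v (fun _ => 1) = (2 * Real.pi)⁻¹ * turn d (fun k => toC (v (k : ZMod d))) := by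
  unfold polyC turn
  rw [sum_ZMod]
  congr 1
  apply Finset.sum_congr rfl
  intro k _
  congr 1
  unfold normalVec
  push_cast
  rw [show (k : ZMod d) + 1 + 1 = k + 2 by ring, mul_div_mul_left _ _ (by simp)]

lemma key {d : ℕ} [NeZero d] {v : ZMod d → ℤ × ℤ} (h : IsSimplePolygon v) (hA : 0 < polyA v) :
    polyC v (fun _ => 1) = 1 ∧ 3 ≤ polyB v (fun _ => 1) ∧
      (polyB v (fun _ => 1) : ℝ) - 2 ≤ 2 * polyA v := by
  have hs := simple_SP h
  have hB : 3 ≤ polyB v (fun _ => 1) := by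
    rw [polyB_eq]
    have : ∑ k ∈ Finset.range d, (1 : ℤ) ≤ Sm gc d (fun k => v (k : ZMod d)) := by
      apply Finset.sum_le_sum
      intro k _
      apply gc_pos
      push_cast
      exact h.2.1 _
    simp at this
    have := h.1
    omega
  obtain ⟨s, hs1, ht⟩ := turn_pm hs
  have hp := pick d _ hs s hs1 ht
  rw [← polyB_eq] at hp
  rw [polyA_eq2] at hA
  have hD : 0 < Sm det d (fun k => v (k : ZMod d)) := by
    have : (0:ℝ) < (Sm det d (fun k => v (k : ZMod d)) : ℤ) := by linarith
    exact_mod_cast this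
  rcases hs1 with rfl | rfl
  · refine ⟨?_, hB, ?_⟩
    · rw [polyC_eq, ht]
      have := Real.pi_pos
      push_cast
      field_simp
    · rw [polyA_eq2]
      have : ((polyB v (fun _ => 1) - 2 : ℤ) : ℝ) ≤ ((1 * Sm det d (fun k => v (k : ZMod d)) : ℤ) : ℝ) := by
        exact_mod_cast hp
      push_cast at this
      linarith
  · omega

lemma mem_seg {p q : ℤ × ℤ} {x : ℝ × ℝ} (h : x ∈ segment ℝ (toR p) (toR q)) :
    ∃ t : ℝ, 0 ≤ t ∧ t ≤ 1 ∧ x.1 = (1 - t) * p.1 + t * q.1 ∧ x.2 = (1 - t) * p.2 + t * q.2 := by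
  obtain ⟨a, b, ha, hb, hab, rfl⟩ := h
  refine ⟨b, hb, by linarith, ?_, ?_⟩ <;>
  · rw [← hab]; simp [toR]

lemma adj_iff {p q r : ℤ × ℤ} (H : ∀ t u : ℝ, 0 ≤ t → t ≤ 1 → 0 ≤ u → u ≤ 1 →
      (1 - t) * p.1 + t * q.1 = (1 - u) * q.1 + u * r.1 →
      (1 - t) * p.2 + t * q.2 = (1 - u) * q.2 + u * r.2 → t = 1) :
    segment ℝ (toR p) (toR q) ∩ segment ℝ (toR q) (toR r) = {toR q} := by
  apply Set.Subset.antisymm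
  · rintro x ⟨hx, hy⟩
    obtain ⟨t, t0, t1, e1, e2⟩ := mem_seg hx
    obtain ⟨u, u0, u1, e3, e4⟩ := mem_seg hy
    have := H t u t0 t1 u0 u1 (by rw [← e1, e3]) (by rw [← e2, e4])
    subst this
    exact Prod.ext (by simp [e1, toR]) (by simp [e2, toR])
  · rintro x rfl
    exact ⟨right_mem_segment _ _ _, left_mem_segment _ _ _⟩

lemma dis_iff {p q r s : ℤ × ℤ} (H : ∀ t u : ℝ, 0 ≤ t → t ≤ 1 → 0 ≤ u → u ≤ 1 →
      (1 - t) * p.1 + t * q.1 = (1 - u) * r.1 + u * s.1 →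
      (1 - t) * p.2 + t * q.2 = (1 - u) * r.2 + u * s.2 → False) :
    segment ℝ (toR p) (toR q) ∩ segment ℝ (toR r) (toR s) = ∅ := by
  rw [Set.eq_empty_iff_forall_notMem]
  rintro x ⟨hx, hy⟩
  obtain ⟨t, t0, t1, e1, e2⟩ := mem_seg hx
  obtain ⟨u, u0, u1, e3, e4⟩ := mem_seg hy
  exact H t u t0 t1 u0 u1 (by rw [← e1, e3]) (by rw [← e2, e4])

def v3 (m : ℤ) : ZMod 3 → ℤ × ℤ := (![(0, 0), (m, 2), (0, 1)] : Fin 3 → ℤ × ℤ)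
def v4 (n m : ℤ) : ZMod 4 → ℤ × ℤ := (![(0, 0), (n, 0), (m, 2), (0, 1)] : Fin 4 → ℤ × ℤ)

lemma v3_simple {m : ℤ} (hm : 0 < m) : IsSimplePolygon (v3 m) := by
  have hm' : (0:ℝ) < m := by exact_mod_cast hm
  refine ⟨le_refl _, ?_, ?_, ?_⟩
  · intro i
    change Fin 3 at i
    fin_cases i
    · show ((0:ℤ), (0:ℤ)) ≠ (m, 2); simp
    · show ((m:ℤ), (2:ℤ)) ≠ (0, 1); simp
    · show ((0:ℤ), (1:ℤ)) ≠ (0, 0); simp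
  · intro i
    change Fin 3 at i
    fin_cases i
    · show segment ℝ (toR (0, 0)) (toR (m, 2)) ∩ segment ℝ (toR (m, 2)) (toR (0, 1)) = {toR (m, 2)}
      apply adj_iff
      intro t u _ _ _ _ e1 e2
      push_cast at e1 e2
      have : t = 1 - u := by nlinarith
      linarith
    · show segment ℝ (toR (m, 2)) (toR (0, 1)) ∩ segment ℝ (toR (0, 1)) (toR (0, 0)) = {toR (0, 1)}
      apply adj_iff
      intro t u _ _ _ _ e1 e2
      push_cast at e1 e2
      nlinarith
    · show segment ℝ (toR (0, 1)) (toR (0, 0)) ∩ segment ℝ (toR (0, 0)) (toR (m, 2)) = {toR (0, 0)}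
      apply adj_iff
      intro t u _ _ _ _ e1 e2
      push_cast at e1 e2
      have : u = 0 := by nlinarith
      linarith
  · have : ∀ i j : ZMod 3, i ≠ j → j ≠ i + 1 → i ≠ j + 1 → False := by decide
    intro i j h1 h2 h3
    exact (this i j h1 h2 h3).elim

lemma v4_simple {n m : ℤ} (hn : 0 < n) (hm : 0 < m + n) : IsSimplePolygon (v4 n m) := by
  have hn' : (0:ℝ) < n := by exact_mod_cast hn
  have hm' : (0:ℝ) < m + n := by exact_mod_cast hm
  have D02 : segment ℝ (toR (0, 0)) (toR (n, 0)) ∩ segment ℝ (toR (m, 2)) (toR (0, 1)) = ∅ := by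
    apply dis_iff
    intro t u _ _ _ _ e1 e2
    push_cast at e1 e2
    linarith
  have D13 : segment ℝ (toR (n, 0)) (toR (m, 2)) ∩ segment ℝ (toR (0, 1)) (toR (0, 0)) = ∅ := by
    apply dis_iff
    intro t u t0 _ u0 _ e1 e2
    push_cast at e1 e2
    have h1 : (1 - 2 * t) * n + t * (m + n) = 0 := by linarith
    have h2 : 0 ≤ 1 - 2 * t := by linarith
    have h3 := mul_nonneg h2 hn'.le
    have h4 := mul_nonneg t0 hm'.le
    have h5 : t = 0 := by nlinarith
    subst h5
    linarith
  refine ⟨by norm_num, ?_, ?_, ?_⟩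
  · intro i
    change Fin 4 at i
    fin_cases i
    · show ((0:ℤ), (0:ℤ)) ≠ (n, 0); simp; omega
    · show ((n:ℤ), (0:ℤ)) ≠ (m, 2); simp
    · show ((m:ℤ), (2:ℤ)) ≠ (0, 1); simp
    · show ((0:ℤ), (1:ℤ)) ≠ (0, 0); simp
  · intro i
    change Fin 4 at i
    fin_cases i
    · show segment ℝ (toR (0, 0)) (toR (n, 0)) ∩ segment ℝ (toR (n, 0)) (toR (m, 2)) = {toR (n, 0)}
      apply adj_iff
      intro t u _ _ _ _ e1 e2
      push_cast at e1 e2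
      have : u = 0 := by linarith
      subst this
      have : (t - 1) * (n : ℝ) = 0 := by linarith
      rcases mul_eq_zero.1 this with h | h <;> linarith
    · show segment ℝ (toR (n, 0)) (toR (m, 2)) ∩ segment ℝ (toR (m, 2)) (toR (0, 1)) = {toR (m, 2)}
      apply adj_iff
      intro t u _ _ _ _ e1 e2
      push_cast at e1 e2
      have : u = 2 - 2 * t := by linarith
      subst this
      have : (1 - t) * ((m : ℝ) + n) = 0 := by linarith
      rcases mul_eq_zero.1 this with h | h <;> linarith
    · show segment ℝ (toR (m, 2)) (toR (0, 1)) ∩ segment ℝ (toR (0, 1)) (toR (0, 0)) = {toR (0, 1)}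
      apply adj_iff
      intro t u _ _ _ _ e1 e2
      push_cast at e1 e2
      linarith
    · show segment ℝ (toR (0, 1)) (toR (0, 0)) ∩ segment ℝ (toR (0, 0)) (toR (n, 0)) = {toR (0, 0)}
      apply adj_iff
      intro t u _ _ _ _ e1 e2
      push_cast at e1 e2
      linarith
  · have : ∀ i j : ZMod 4, i ≠ j → j ≠ i + 1 → i ≠ j + 1 →
      (i = 0 ∧ j = 2) ∨ (i = 2 ∧ j = 0) ∨ (i = 1 ∧ j = 3) ∨ (i = 3 ∧ j = 1) := by decide
    intro i j h1 h2 h3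
    rcases this i j h1 h2 h3 with ⟨rfl, rfl⟩ | ⟨rfl, rfl⟩ | ⟨rfl, rfl⟩ | ⟨rfl, rfl⟩
    · exact D02
    · rw [Set.inter_comm]; exact D02
    · exact D13
    · rw [Set.inter_comm]; exact D13

lemma gcd_odd (k : ℤ) : Int.gcd (2 * k + 1) 2 = 1 := by
  rw [Int.gcd_comm, ← Int.isCoprime_iff_gcd_eq_one]
  exact ⟨-k, 1, by ring⟩

lemma v3_vals (I : ℤ) : Sm gc 3 (fun k => v3 (2 * I + 1) (k : ZMod 3)) = 3 ∧
    Sm det 3 (fun k => v3 (2 * I + 1) (k : ZMod 3)) = 2 * I + 1 := by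
  unfold Sm
  simp only [Finset.sum_range_succ, Finset.sum_range_zero]
  have e0 : v3 (2 * I + 1) ((0:ℕ) : ZMod 3) = (0, 0) := rfl
  have e1 : v3 (2 * I + 1) ((0 + 1:ℕ) : ZMod 3) = (2 * I + 1, 2) := rfl
  have e1' : v3 (2 * I + 1) ((1:ℕ) : ZMod 3) = (2 * I + 1, 2) := rfl
  have e2 : v3 (2 * I + 1) ((1 + 1:ℕ) : ZMod 3) = (0, 1) := rfl
  have e2' : v3 (2 * I + 1) ((2:ℕ) : ZMod 3) = (0, 1) := rfl
  have e3 : v3 (2 * I + 1) ((2 + 1:ℕ) : ZMod 3) = (0, 0) := rfl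
  rw [e0, e1, e2, e3]
  constructor
  · simp [gc, gcd_odd]
  · simp [det]

lemma v4_vals (I n : ℤ) (hn : 0 < n) :
    Sm gc 4 (fun k => v4 n (2 * I + 1 - n) (k : ZMod 4)) = n + 3 ∧
    Sm det 4 (fun k => v4 n (2 * I + 1 - n) (k : ZMod 4)) = n + 2 * I + 1 := by
  unfold Sm
  simp only [Finset.sum_range_succ, Finset.sum_range_zero]
  generalize hm : 2 * I + 1 - n = m
  have e0 : v4 n m ((0:ℕ) : ZMod 4) = (0, 0) := rfl
  have e1 : v4 n m ((0 + 1:ℕ) : ZMod 4) = (n, 0) := rfl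
  have e1' : v4 n m ((1:ℕ) : ZMod 4) = (n, 0) := rfl
  have e2 : v4 n m ((1 + 1:ℕ) : ZMod 4) = (m, 2) := rfl
  have e2' : v4 n m ((2:ℕ) : ZMod 4) = (m, 2) := rfl
  have e3 : v4 n m ((2 + 1:ℕ) : ZMod 4) = (0, 1) := rfl
  have e3' : v4 n m ((3:ℕ) : ZMod 4) = (0, 1) := rfl
  have e4 : v4 n m ((3 + 1:ℕ) : ZMod 4) = (0, 0) := rfl
  rw [e0, e1, e2, e3, e4]
  constructor
  · have : m - n = 2 * (I - n) + 1 := by omega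
    simp [gc, this, gcd_odd, abs_of_pos hn]
    ring
  · simp [det]; omega

lemma conv (I n : ℤ) (hI : 0 ≤ I) (hn : 0 ≤ n) :
    ∃ (d : ℕ) (_ : NeZero d) (v : ZMod d → ℤ × ℤ),
      IsSimplePolygon v ∧ polyA v = ((n + 2 * I + 1 : ℤ) : ℝ) / 2 ∧ polyB v (fun _ => 1) = n + 3 := by
  rcases hn.lt_or_eq with h | h
  · refine ⟨4, inferInstance, v4 n (2 * I + 1 - n), v4_simple h (by omega), ?_, ?_⟩
    · rw [polyA_eq2, (v4_vals I n h).2]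
    · rw [polyB_eq, (v4_vals I n h).1]
  · subst h
    refine ⟨3, inferInstance, v3 (2 * I + 1), v3_simple (by omega), ?_, ?_⟩
    · rw [polyA_eq2, (v3_vals I).2, zero_add]
    · rw [polyB_eq, (v3_vals I).1]; rfl


theorem stmt16 (a b : ℝ) (c : ℤ)
    (hA1 : ∃ m : ℤ, a = m / 2) (hA2 : ∃ m : ℤ, b = m / 2)
    (hA3 : ∃ m : ℤ, a + b = m) :
    (∃ (d : ℕ) (_ : NeZero d) (v : ZMod d → ℤ × ℤ),
        IsSimplePolygon v ∧ 0 < polyA v ∧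
        polyA v = a ∧
        (polyB v (fun _ => 1) : ℝ) / 2 = b ∧
        polyC v (fun _ => 1) = c)
      ↔ ((c : ℝ) = 1 ∧ b ≤ a + 1 ∧ 3 / 2 ≤ b) := by

  constructor
  · rintro ⟨d, _, v, hs, h0, rfl, rfl, hc⟩
    obtain ⟨k1, k2, k3⟩ := key hs h0
    have k2' : (3:ℝ) ≤ polyB v (fun _ => 1) := by exact_mod_cast k2
    exact ⟨by rw [← hc, k1], by linarith, by linarith⟩
  · rintro ⟨h1, h2, h3⟩
    obtain ⟨N, rfl⟩ := hA1
    obtain ⟨B, rfl⟩ := hA2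
    obtain ⟨M, hM⟩ := hA3
    have hB : 3 ≤ B := by
      have : (3:ℝ) ≤ B := by linarith
      exact_mod_cast this
    have hN : B ≤ N + 2 := by
      have : (B:ℝ) ≤ N + 2 := by linarith
      exact_mod_cast this
    have hNB : N + B = 2 * M := by
      have : (N:ℝ) + B = 2 * M := by linarith
      exact_mod_cast this
    obtain ⟨d, hd, v, hs, hA, hBv⟩ := conv (M - B + 1) (B - 3) (by omega) (by omega)
    rw [show B - 3 + 2 * (M - B + 1) + 1 = N by omega] at hA
    have hNpos : (0:ℝ) < N := by
      have : 0 < N := by omega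
      exact_mod_cast this
    have h0 : 0 < polyA v := by rw [hA]; linarith
    refine ⟨d, hd, v, hs, h0, hA, ?_, ?_⟩
    · rw [hBv]; push_cast; ring
    · rw [(key hs h0).1, h1]
end

section
/- Let P be a convex lattice polygon. Then (A(P), (1/2)B(P)) satisfies one of: (1) A(P) + 1 = (1/2)B(P) ≥ 3/2 (i.e. P has no interior lattice points); (2) (1/2)B(P) ≤ A(P)/2 + 2 and (1/2)B(P) ≥ 3/2; or (3) (A(P), (1/2)B(P)) = (9/2, 9/2). Equivalently, if P has at least one interior lattice point then B(P) ≤ 2·#(interior lattice points of P) + 6, with equality beyond forced only for the triangle with vertices (0,0), (3,0), (0,3). -/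
open MeasureTheory

noncomputable def lin (a b c d : ℝ) : ℝ × ℝ →ₗ[ℝ] ℝ × ℝ :=
  Matrix.toLin (Module.Basis.finTwoProd ℝ) (Module.Basis.finTwoProd ℝ) !![a, b; c, d]

lemma lin_apply (a b c d : ℝ) (z : ℝ × ℝ) :
    lin a b c d z = (a * z.1 + b * z.2, c * z.1 + d * z.2) := by
  simp [lin, Matrix.toLin_finTwoProd_apply]

lemma vol_lin (a b c d : ℝ) (s : Set (ℝ × ℝ)) :
    volume (lin a b c d '' s) = ENNReal.ofReal |a * d - b * c| * volume s := by
  rw [Measure.addHaar_image_linearMap, lin, LinearMap.det_toLin, Matrix.det_fin_two_of]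

def stdK : Set (ℝ × ℝ) := regionBetween (fun _ => 0) (fun x => 1 - x) (Set.Ioo 0 1)

lemma vol_stdK : volume stdK = ENNReal.ofReal (1 / 2) := by
  rw [stdK]
  have : (volume : Measure (ℝ × ℝ)) = (volume : Measure ℝ).prod volume := rfl
  rw [this, volume_regionBetween_eq_integral]
  · congr 1
    simp only [Pi.sub_apply, sub_zero]
    rw [← integral_Ioc_eq_integral_Ioo, ← intervalIntegral.integral_of_le (by norm_num),
      intervalIntegral.integral_comp_sub_left (fun x : ℝ => x), integral_id]
    norm_num
  · exact (continuous_const.integrableOn_Icc (a := 0) (b := 1)).mono_set Set.Ioo_subset_Icc_self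
  · exact ((continuous_const.sub continuous_id).integrableOn_Icc (a := 0) (b := 1)).mono_set Set.Ioo_subset_Icc_self
  · exact measurableSet_Ioo
  · intro x hx; simp only [Set.mem_Ioo] at hx; simp; linarith [hx.2]

def det3 (A C v : ℝ × ℝ) : ℝ := (C.1 - A.1) * (v.2 - A.2) - (C.2 - A.2) * (v.1 - A.1)

def Tri (A C v : ℝ × ℝ) : Set (ℝ × ℝ) :=
  (fun z => A + z) '' (lin (C.1 - A.1) (v.1 - A.1) (C.2 - A.2) (v.2 - A.2) '' stdK)

lemma vol_Tri (A C v : ℝ × ℝ) : volume (Tri A C v) = ENNReal.ofReal (|det3 A C v| / 2) := by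
  rw [Tri, Set.image_add_left, measure_preimage_add, vol_lin, vol_stdK, ← ENNReal.ofReal_mul (abs_nonneg _)]
  congr 1
  rw [det3, div_eq_mul_one_div |_| (2 : ℝ)]
  congr 2; ring

lemma Tri_mem {A C v z : ℝ × ℝ} (h : z ∈ Tri A C v) :
    ∃ s t : ℝ, 0 < s ∧ 0 < t ∧ s + t < 1 ∧
      z = (A.1 + s * (C.1 - A.1) + t * (v.1 - A.1), A.2 + s * (C.2 - A.2) + t * (v.2 - A.2)) := by
  obtain ⟨w, ⟨u, hu, rfl⟩, rfl⟩ := h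
  simp only [stdK, regionBetween, Set.mem_Ioo, Set.mem_ofPred_eq] at hu
  refine ⟨u.1, u.2, hu.1.1, hu.2.1, by linarith [hu.2.2], ?_⟩
  rw [lin_apply]
  ext <;> simp <;> ring

lemma Tri_subset {A C v : ℝ × ℝ} {P : Set (ℝ × ℝ)} (hP : Convex ℝ P) (hA : A ∈ P) (hC : C ∈ P)
    (hv : v ∈ P) : Tri A C v ⊆ P := by
  intro z hz
  obtain ⟨s, t, hs, ht, hst, rfl⟩ := Tri_mem hz
  have h := hP.sum_mem (t := Finset.univ) (w := ![1 - s - t, s, t]) (z := ![A, C, v])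
    (by intro i _; fin_cases i <;> simp <;> linarith)
    (by simp [Fin.sum_univ_three]; ring)
    (by intro i _; fin_cases i <;> simp <;> assumption)
  convert h using 1
  simp [Fin.sum_univ_three]
  ext <;> simp <;> ring

lemma Tri_det {A C v z : ℝ × ℝ} (h : z ∈ Tri A C v) : ∃ t : ℝ, 0 < t ∧ det3 A C z = t * det3 A C v := by
  obtain ⟨s, t, hs, ht, hst, rfl⟩ := Tri_mem h
  exact ⟨t, ht, by simp only [det3]; ring⟩

lemma Tri_meas {A C v : ℝ × ℝ} (h : det3 A C v ≠ 0) : MeasurableSet (Tri A C v) := by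
  have hK : MeasurableSet stdK := measurableSet_regionBetween measurable_const
    (measurable_const.sub measurable_id) measurableSet_Ioo
  rw [Tri, Set.image_add_left]
  apply measurable_const_add _
  have hd : LinearMap.det (lin (C.1 - A.1) (v.1 - A.1) (C.2 - A.2) (v.2 - A.2)) ≠ 0 := by
    rw [lin, LinearMap.det_toLin, Matrix.det_fin_two_of]
    intro h'; apply h; rw [det3]; linarith
  set f := lin (C.1 - A.1) (v.1 - A.1) (C.2 - A.2) (v.2 - A.2)
  have hinj : Function.Injective f := by
    have := (LinearMap.equivOfDetNeZero f hd).injective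
    exact this
  exact hK.image_of_continuousOn_injOn f.continuous_of_finiteDimensional.continuousOn hinj.injOn

lemma add_tri {A C v : ℝ × ℝ} {P T : Set (ℝ × ℝ)} (hP : Convex ℝ P) (hT : T ⊆ P)
    (hA : A ∈ P) (hC : C ∈ P) (hv : v ∈ P) (hTn : ∀ z ∈ T, det3 A C z ≤ 0) (hd : 0 < det3 A C v) :
    volume T + ENNReal.ofReal (det3 A C v / 2) ≤ volume P := by
  have h1 := vol_Tri A C v
  rw [abs_of_pos hd] at h1
  rw [← h1, ← measure_union _ (Tri_meas hd.ne')]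
  · exact measure_mono (Set.union_subset hT (Tri_subset hP hA hC hv))
  · rw [Set.disjoint_left]
    intro z hz hz'
    obtain ⟨t, ht, h⟩ := Tri_det hz'
    have := hTn z hz
    have := mul_pos ht hd
    linarith

lemma quad {A C y y' : ℝ × ℝ} {P : Set (ℝ × ℝ)} (hP : Convex ℝ P)
    (hA : A ∈ P) (hC : C ∈ P) (hy : y ∈ P) (hy' : y' ∈ P) :
    ENNReal.ofReal ((det3 A C y - det3 A C y') / 2) ≤ volume P := by
  have key : ∀ w ∈ P, ENNReal.ofReal (|det3 A C w| / 2) ≤ volume P := fun w hw => by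
    rw [← vol_Tri]; exact measure_mono (Tri_subset hP hA hC hw)
  by_cases h1 : det3 A C y ≤ 0
  · refine le_trans (ENNReal.ofReal_le_ofReal ?_) (key y' hy')
    have := neg_abs_le (det3 A C y'); linarith
  by_cases h2 : 0 ≤ det3 A C y'
  · refine le_trans (ENNReal.ofReal_le_ofReal ?_) (key y hy)
    have := le_abs_self (det3 A C y); linarith
  push Not at h1 h2
  have := add_tri hP (Tri_subset hP hA hC hy') hA hC hy (T := Tri A C y') (by
    intro z hz
    obtain ⟨t, ht, h⟩ := Tri_det hz
    rw [h]; nlinarith) h1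
  rw [vol_Tri, abs_of_neg h2, ← ENNReal.ofReal_add (by linarith) (by linarith)] at this
  convert this using 2; ring

/-- upper bound for a trapezoid -/
lemma trap_upper {P : Set (ℝ × ℝ)} (m p u0 u1 c0 c1 : ℝ) (hp : 0 < p) (hu : u0 ≤ u1) (hc : c0 ≤ c1)
    (hPm : MeasurableSet P)
    (h : ∀ z ∈ P, m ≤ z.1 ∧ z.1 ≤ m + p ∧ p * u0 + (c0 - u0) * (z.1 - m) ≤ p * z.2 ∧
      p * z.2 ≤ p * u1 + (c1 - u1) * (z.1 - m)) :
    volume P ≤ ENNReal.ofReal (p * ((u1 - u0) + (c1 - c0)) / 2) := by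
  have hvol : (volume : Measure (ℝ × ℝ)) = (volume : Measure ℝ).prod volume := rfl
  rw [hvol, Measure.prod_apply hPm]
  set g : ℝ → ℝ := fun x => (u1 - u0) + ((c1 - c0) - (u1 - u0)) / p * (x - m) with hg
  have hgc : Continuous g := by fun_prop
  have hgn : ∀ x ∈ Set.Icc m (m + p), 0 ≤ g x := by
    intro x hx
    have : g x = ((u1 - u0) * (m + p - x) + (c1 - c0) * (x - m)) / p := by
      simp only [hg]; field_simp; ring
    rw [this]
    apply div_nonneg _ hp.le
    have := hx.1; have := hx.2
    apply add_nonneg <;> apply mul_nonneg <;> linarith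
  have hle : ∀ x, volume (Prod.mk x ⁻¹' P) ≤ (Set.Icc m (m + p)).indicator (fun x => ENNReal.ofReal (g x)) x := by
    intro x
    by_cases hx : x ∈ Set.Icc m (m + p)
    · rw [Set.indicator_of_mem hx]
      have : Prod.mk x ⁻¹' P ⊆ Set.Icc (u0 + (c0 - u0) / p * (x - m)) (u1 + (c1 - u1) / p * (x - m)) := by
        intro y hy
        obtain ⟨_, _, h1, h2⟩ := h _ hy
        simp only at h1 h2
        constructor
        · rw [← mul_le_mul_iff_right₀ hp]
          refine le_trans (le_of_eq ?_) h1
          field_simp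
        · rw [← mul_le_mul_iff_right₀ hp]
          refine le_trans h2 (le_of_eq ?_)
          field_simp
      refine (measure_mono this).trans ?_
      rw [Real.volume_Icc]
      apply le_of_eq; congr 1; simp only [hg]; field_simp; ring
    · rw [Set.indicator_of_notMem hx]
      have : Prod.mk x ⁻¹' P = ∅ := by
        ext y; simp only [Set.mem_preimage, Set.mem_empty_iff_false, iff_false]
        intro hy; exact hx ⟨(h _ hy).1, (h _ hy).2.1⟩
      rw [this]; simp
  refine (lintegral_mono hle).trans ?_
  rw [lintegral_indicator measurableSet_Icc,
    ← ofReal_integral_eq_lintegral_ofReal hgc.integrableOn_Icc]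
  · apply le_of_eq; congr 1
    rw [integral_Icc_eq_integral_Ioc, ← intervalIntegral.integral_of_le (by linarith)]
    simp only [hg]
    rw [intervalIntegral.integral_add (by simp) (by apply Continuous.intervalIntegrable; fun_prop),
      intervalIntegral.integral_const_mul,
      intervalIntegral.integral_comp_sub_right (fun x : ℝ => x), integral_id]
    simp only [intervalIntegral.integral_const, smul_eq_mul]
    field_simp; ring
  · filter_upwards [ae_restrict_mem measurableSet_Icc] with x hx using hgn x hx

lemma front {P : Set (ℝ × ℝ)} {s : ℝ × ℝ} (α β : ℝ) (h0 : α ≠ 0 ∨ β ≠ 0)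
    (h : ∀ z ∈ P, α * z.1 + β * z.2 ≤ α * s.1 + β * s.2) : s ∉ interior P := by
  intro hs
  rw [mem_interior_iff_mem_nhds] at hs
  have hc : Filter.Tendsto (fun t : ℝ => (s.1 + t * α, s.2 + t * β)) (nhdsWithin 0 (Set.Ioi 0)) (nhds s) := by
    have : Continuous (fun t : ℝ => (s.1 + t * α, s.2 + t * β)) := by fun_prop
    have := this.tendsto 0
    simp only [zero_mul, add_zero] at this
    exact this.mono_left nhdsWithin_le_nhds
  obtain ⟨t, ht, ht0⟩ := ((hc.eventually hs).and self_mem_nhdsWithin).exists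
  have := h _ ht
  simp only at this ht0
  have h2 : 0 < α ^ 2 + β ^ 2 := by
    rcases h0 with h0 | h0 <;> positivity
  nlinarith [mul_pos ht0 h2]

lemma hull_le {S : Finset (ℤ × ℤ)} {P : Set (ℝ × ℝ)}
    (hP : P = convexHull ℝ (toR '' (S : Set (ℤ × ℤ)))) (α β c : ℝ)
    (h : ∀ s ∈ S, α * (s.1 : ℝ) + β * (s.2 : ℝ) ≤ c) : ∀ z ∈ P, α * z.1 + β * z.2 ≤ c := by
  have : P ⊆ {z : ℝ × ℝ | α * z.1 + β * z.2 ≤ c} := by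
    rw [hP]
    apply convexHull_min
    · rintro _ ⟨s, hs, rfl⟩; exact h s hs
    · apply convex_halfSpace_le (f := fun z : ℝ × ℝ => α * z.1 + β * z.2)
      constructor
      · intro x y; simp; ring
      · intro c x; simp; ring
  exact this

def Concl (P : Set (ℝ × ℝ)) : Prop :=
    (((volume P).toReal + 1 = ({p : ℤ × ℤ | toR p ∈ frontier P}.ncard : ℝ) / 2) ∧
        3 / 2 ≤ ({p : ℤ × ℤ | toR p ∈ frontier P}.ncard : ℝ) / 2) ∨
    ((({p : ℤ × ℤ | toR p ∈ frontier P}.ncard : ℝ) / 2 ≤ (volume P).toReal / 2 + 2) ∧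
        3 / 2 ≤ ({p : ℤ × ℤ | toR p ∈ frontier P}.ncard : ℝ) / 2) ∨
    ((volume P).toReal = 9 / 2 ∧
        ({p : ℤ × ℤ | toR p ∈ frontier P}.ncard : ℝ) / 2 = 9 / 2)

lemma int_at {P : Set (ℝ × ℝ)} (hP : Convex ℝ P) (hint : (interior P).Nonempty) {A C : ℝ × ℝ}
    (hA : A ∈ P) (hC : C ∈ P) {x : ℝ} (h1 : A.1 < x) (h2 : x < C.1) : ∃ y, (x, y) ∈ interior P := by
  obtain ⟨z, hz⟩ := hint
  rcases lt_trichotomy z.1 x with h | h | h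
  · set t := (x - z.1) / (C.1 - z.1)
    have hd : 0 < C.1 - z.1 := by linarith
    have ht0 : 0 < t := div_pos (by linarith) hd
    have ht1 : t < 1 := by rw [div_lt_one hd]; linarith
    have ht : t * (C.1 - z.1) = x - z.1 := div_mul_cancel₀ _ hd.ne'
    have := hP.combo_interior_self_mem_interior hz hC (a := 1 - t) (b := t) (by linarith) ht0.le (by ring)
    refine ⟨((1 - t) • z + t • C).2, ?_⟩
    convert this using 1
    ext
    · simp; linarith
    · rfl
  · exact ⟨z.2, by rw [← h]; exact hz⟩
  · set t := (z.1 - x) / (z.1 - A.1)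
    have hd : 0 < z.1 - A.1 := by linarith
    have ht0 : 0 < t := div_pos (by linarith) hd
    have ht1 : t < 1 := by rw [div_lt_one hd]; linarith
    have ht : t * (z.1 - A.1) = z.1 - x := div_mul_cancel₀ _ hd.ne'
    have := hP.combo_interior_self_mem_interior hz hA (a := 1 - t) (b := t) (by linarith) ht0.le (by ring)
    refine ⟨((1 - t) • z + t • A).2, ?_⟩
    convert this using 1
    ext
    · simp; linarith
    · rfl

lemma mid_int {P : Set (ℝ × ℝ)} (hP : Convex ℝ P) {x c y w : ℝ} (hc : (x, c) ∈ interior P)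
    (hw : (x, w) ∈ P) (h : (c ≤ y ∧ y < w) ∨ (w < y ∧ y ≤ c)) : (x, y) ∈ interior P := by
  set t := (y - c) / (w - c)
  have hd : w - c ≠ 0 := by
    intro h'; rcases h with h | h <;> linarith
  have ht : t * (w - c) = y - c := div_mul_cancel₀ _ hd
  have ht0 : 0 ≤ t := by
    rcases h with h | h
    · exact div_nonneg (by linarith) (by linarith)
    · exact div_nonneg_of_nonpos (by linarith) (by linarith)
  have ht1 : t < 1 := by
    rcases h with h | h
    · rw [div_lt_one (by linarith)]; linarith
    · rw [div_lt_one_of_neg (by linarith)]; linarith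
  have := hP.combo_interior_self_mem_interior hc hw (a := 1 - t) (b := t) (by linarith) ht0 (by ring)
  convert this using 1
  ext
  · simp; ring
  · simp; linarith

lemma col_card {P : Set (ℝ × ℝ)} (hP : Convex ℝ P) {x : ℝ} (hc : ∃ c, (x, c) ∈ interior P)
    (G : Finset ℤ) (hG : ∀ y ∈ G, (x, (y : ℝ)) ∈ P ∧ (x, (y : ℝ)) ∉ interior P) : G.card ≤ 2 := by
  obtain ⟨c, hc⟩ := hc
  by_contra hcard
  push Not at hcard
  have hne : G.Nonempty := Finset.card_pos.mp (by omega)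
  have : ∃ y ∈ G, y ≠ G.min' hne ∧ y ≠ G.max' hne := by
    by_contra hcon
    push Not at hcon
    have : G ⊆ {G.min' hne, G.max' hne} := by
      intro y hy
      simp only [Finset.mem_insert, Finset.mem_singleton]
      by_cases h : y = G.min' hne
      · left; exact h
      · right; exact hcon y hy h
    have := (Finset.card_le_card this).trans Finset.card_le_two
    omega
  obtain ⟨y, hy, h1, h2⟩ := this
  have h1' : G.min' hne < y := lt_of_le_of_ne (G.min'_le y hy) (Ne.symm h1)
  have h2' : y < G.max' hne := lt_of_le_of_ne (G.le_max' y hy) h2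
  apply (hG y hy).2
  rcases le_total c y with h | h
  · exact mid_int hP hc (hG _ (G.max'_mem hne)).1 (Or.inl ⟨h, by exact_mod_cast h2'⟩)
  · exact mid_int hP hc (hG _ (G.min'_mem hne)).1 (Or.inr ⟨by exact_mod_cast h1', h⟩)

lemma col {S : Finset (ℤ × ℤ)} {P : Set (ℝ × ℝ)} (hP : Convex ℝ P)
    (hS : ∀ z, toR z ∈ P ↔ z ∈ S) (x : ℤ) (h : ∃ s ∈ S, s.1 = x) :
    ∃ u0 u1 : ℤ, u0 ≤ u1 ∧ ∀ y, (x, y) ∈ S ↔ u0 ≤ y ∧ y ≤ u1 := by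
  set G := (S.filter (fun s => s.1 = x)).image Prod.snd with hG
  have hGm : ∀ y, y ∈ G ↔ (x, y) ∈ S := by
    intro y
    simp only [hG, Finset.mem_image, Finset.mem_filter]
    constructor
    · rintro ⟨⟨a, b⟩, ⟨h1, rfl⟩, rfl⟩; exact h1
    · intro h; exact ⟨(x, y), ⟨h, rfl⟩, rfl⟩
  have hne : G.Nonempty := by
    obtain ⟨⟨a, b⟩, hs, rfl⟩ := h
    exact ⟨b, (hGm b).2 hs⟩
  refine ⟨G.min' hne, G.max' hne, G.min'_le_max' hne, fun y => ?_⟩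
  rw [← hGm]
  refine ⟨fun h => ⟨G.min'_le y h, G.le_max' y h⟩, fun ⟨h1, h2⟩ => ?_⟩
  have e1 := (hS _).2 ((hGm _).1 (G.min'_mem hne))
  have e2 := (hS _).2 ((hGm _).1 (G.max'_mem hne))
  rw [hGm, ← hS]
  have h1r : ((G.min' hne : ℤ) : ℝ) ≤ y := by exact_mod_cast h1
  have h2r : (y : ℝ) ≤ ((G.max' hne : ℤ) : ℝ) := by exact_mod_cast h2
  have hy : (y : ℝ) ∈ segment ℝ ((G.min' hne : ℤ) : ℝ) ((G.max' hne : ℤ) : ℝ) := by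
    rw [segment_eq_Icc (h1r.trans h2r)]; exact ⟨h1r, h2r⟩
  obtain ⟨a, b, ha, hb, hab, he⟩ := hy
  have := hP e1 e2 ha hb hab
  convert this using 1
  ext
  · simp [toR]; rw [← add_mul, hab, one_mul]
  · simp [toR]; rw [← he]; simp

/-- pigeonhole for the shear -/
lemma shear_exists (p L n : ℤ) (hp : 0 < p) (hn : 0 ≤ n) (hnp : n ≤ p) :
    ∃ k t : ℤ, L ≤ t ∧ t ≤ L + n ∧ 2 * |t + k * p| ≤ p - n := by
  have h1 := Int.emod_nonneg L hp.ne'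
  have h2 := Int.emod_lt_of_pos L hp
  have h3 := Int.emod_add_mul_ediv L p
  set r := L % p
  set d := L / p
  by_cases h : p ≤ r + n
  · refine ⟨-(d + 1), (d + 1) * p, by linarith, by linarith, ?_⟩
    have : (d + 1) * p + -(d + 1) * p = 0 := by ring
    rw [this]; simp; exact hnp
  push Not at h
  by_cases h' : 2 * r ≤ p - n
  · refine ⟨-d, L, le_rfl, by linarith, ?_⟩
    have : L + -d * p = r := by linarith
    rw [this, abs_of_nonneg h1]; exact h'
  · refine ⟨-(d + 1), L + n, by linarith, le_rfl, ?_⟩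
    have : L + n + -(d + 1) * p = -(p - r - n) := by linarith
    rw [this, abs_neg, abs_of_nonneg (by linarith)]; linarith

open Classical in
lemma core_s17 (S : Finset (ℤ × ℤ)) (P : Set (ℝ × ℝ))
    (hP : P = convexHull ℝ (toR '' (S : Set (ℤ × ℤ)))) (hS : ∀ z, toR z ∈ P ↔ z ∈ S)
    (hint : (interior P).Nonempty) (m p : ℤ) (h0 : ∀ s ∈ S, m ≤ s.1 ∧ s.1 ≤ m + p)
    (hl : ∃ s ∈ S, s.1 = m) (hr : ∃ s ∈ S, s.1 = m + p)
    (hmin : ∀ k : ℤ, ∃ s ∈ S, ∃ t ∈ S, p ≤ (t.2 + k * t.1) - (s.2 + k * s.1)) : Concl P := by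
  have hconv : Convex ℝ P := by rw [hP]; exact convex_convexHull ℝ _
  have hcomp : IsCompact P := by
    rw [hP]; exact ((S.finite_toSet.image _).isCompact_convexHull ℝ)
  have hclosed := hcomp.isClosed
  have hfin : volume P ≠ ⊤ := hcomp.measure_lt_top.ne
  -- frontier points
  set F : Finset (ℤ × ℤ) := S.filter (fun s => toR s ∉ interior P) with hF
  have hFset : {p : ℤ × ℤ | toR p ∈ frontier P} = (F : Set (ℤ × ℤ)) := by
    ext z
    simp only [Set.mem_ofPred_eq, hF, Finset.coe_filter, frontier, hclosed.closure_eq, Set.mem_sdiff, hS]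
  have hncard : {p : ℤ × ℤ | toR p ∈ frontier P}.ncard = F.card := by
    rw [hFset, Set.ncard_coe_finset]
  rw [Concl, hncard]
  clear hncard hFset
  -- p positive
  have hbx : ∀ z ∈ P, (m : ℝ) ≤ z.1 ∧ z.1 ≤ m + p := by
    intro z hz
    constructor
    · have := hull_le hP (-1) 0 (-m) (by
        intro s hs; have := (h0 s hs).1
        have : (m : ℝ) ≤ s.1 := by exact_mod_cast this
        linarith) z hz
      linarith
    · have := hull_le hP 1 0 (m + p) (by
        intro s hs; have := (h0 s hs).2
        have : (s.1 : ℝ) ≤ m + p := by exact_mod_cast this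
        linarith) z hz
      linarith
  have hp : 0 < p := by
    by_contra hp
    push Not at hp
    have hpr : (p : ℝ) ≤ 0 := by exact_mod_cast hp
    obtain ⟨z, hz⟩ := hint
    refine front 1 0 (by simp) ?_ hz
    intro w hw
    have := hbx w hw; have := hbx z (interior_subset hz)
    linarith
  have hpr : (0 : ℝ) < p := by exact_mod_cast hp
  obtain ⟨u0, u1, hu, hU⟩ := col hconv hS m hl
  obtain ⟨c0, c1, hc, hC⟩ := col hconv hS (m + p) hr
  have hfl : ∀ y, u0 ≤ y → y ≤ u1 → (m, y) ∈ F := by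
    intro y h1 h2
    rw [hF, Finset.mem_filter]
    refine ⟨(hU y).2 ⟨h1, h2⟩, front (-1) 0 (by simp) ?_⟩
    intro z hz; have := (hbx z hz).1; simp only [toR]; linarith
  have hfr : ∀ y, c0 ≤ y → y ≤ c1 → (m + p, y) ∈ F := by
    intro y h1 h2
    rw [hF, Finset.mem_filter]
    refine ⟨(hC y).2 ⟨h1, h2⟩, front 1 0 (by simp) ?_⟩
    intro z hz; have := (hbx z hz).2; simp only [toR]; push_cast; linarith
  -- b ≥ 3
  have hb3 : 3 ≤ F.card := by
    have hA := hfl u0 le_rfl hu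
    have hCC := hfr c0 le_rfl hc
    have key : ∃ s ∈ F, (p * (s.2 - u0) - (c0 - u0) * (s.1 - m) : ℤ) ≠ 0 := by
      set f : ℤ × ℤ → ℤ := fun s => p * (s.2 - u0) - (c0 - u0) * (s.1 - m) with hf
      have hne : S.Nonempty := ⟨_, (Finset.mem_filter.1 hA).1⟩
      obtain ⟨s, hs, hsm⟩ := S.exists_max_image f hne
      obtain ⟨t, ht, htm⟩ := S.exists_min_image f hne
      have hsP : ∀ z ∈ P, (-(c0 - u0) : ℝ) * z.1 + p * z.2 ≤ -(c0 - u0) * s.1 + p * s.2 := by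
        apply hull_le hP
        intro w hw
        have := hsm w hw
        simp only [hf] at this
        have h' : ((p * (w.2 - u0) - (c0 - u0) * (w.1 - m) : ℤ) : ℝ) ≤ ((p * (s.2 - u0) - (c0 - u0) * (s.1 - m) : ℤ) : ℝ) := by exact_mod_cast this
        push_cast at h'
        linarith
      have htP : ∀ z ∈ P, ((c0 - u0) : ℝ) * z.1 + (-p) * z.2 ≤ (c0 - u0) * t.1 + (-p) * t.2 := by
        apply hull_le hP
        intro w hw
        have := htm w hw
        simp only [hf] at this
        have h' : ((p * (t.2 - u0) - (c0 - u0) * (t.1 - m) : ℤ) : ℝ) ≤ ((p * (w.2 - u0) - (c0 - u0) * (w.1 - m) : ℤ) : ℝ) := by exact_mod_cast this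
        push_cast at h'
        linarith
      by_contra hcon
      push Not at hcon
      have e1 : f s = 0 := hcon s (Finset.mem_filter.2 ⟨hs, front (-(c0 - u0)) p (Or.inr hpr.ne') hsP⟩)
      have e2 : f t = 0 := hcon t (Finset.mem_filter.2 ⟨ht, front (c0 - u0) (-p) (Or.inr (neg_ne_zero.2 hpr.ne')) htP⟩)
      simp only [hf] at e1 e2
      have e1' : (p * (s.2 - u0) - (c0 - u0) * (s.1 - m) : ℝ) = 0 := by exact_mod_cast e1
      have e2' : (p * (t.2 - u0) - (c0 - u0) * (t.1 - m) : ℝ) = 0 := by exact_mod_cast e2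
      obtain ⟨z, hz⟩ := hint
      refine front (-(c0 - u0)) p (Or.inr hpr.ne') ?_ hz
      intro w hw
      have := hsP w hw
      have := htP z (interior_subset hz)
      linarith
    obtain ⟨s, hs, hs0⟩ := key
    have hsub : ({(m, u0), (m + p, c0), s} : Finset (ℤ × ℤ)) ⊆ F := by
      intro z hz
      simp only [Finset.mem_insert, Finset.mem_singleton] at hz
      rcases hz with rfl | rfl | rfl <;> assumption
    have := Finset.card_le_card hsub
    rw [Finset.card_eq_three.2 ⟨(m, u0), (m + p, c0), s, ?_, ?_, ?_, rfl⟩] at this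
    · exact this
    · intro h; have := congrArg Prod.fst h; simp at this; omega
    · rintro rfl; apply hs0; simp
    · rintro rfl; apply hs0; ring
  have hb3' : (3 : ℝ) / 2 ≤ (F.card : ℝ) / 2 := by
    have : (3 : ℝ) ≤ F.card := by exact_mod_cast hb3
    linarith
  -- upper bound for b
  have hcl : (S.filter (fun s => s.1 = m)).card = (u1 + 1 - u0).toNat := by
    rw [← Int.card_Icc]
    refine Finset.card_bij' (fun s _ => s.2) (fun y _ => (m, y)) ?_ ?_ ?_ ?_
    · rintro ⟨a, b⟩ h; rw [Finset.mem_filter] at h; obtain ⟨h, rfl⟩ := h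
      exact Finset.mem_Icc.2 ((hU b).1 h)
    · intro y hy; exact Finset.mem_filter.2 ⟨(hU y).2 (Finset.mem_Icc.1 hy), rfl⟩
    · rintro ⟨a, b⟩ h; rw [Finset.mem_filter] at h; obtain ⟨h, rfl⟩ := h; rfl
    · intro y hy; rfl
  have hcr : (S.filter (fun s => s.1 = m + p)).card = (c1 + 1 - c0).toNat := by
    rw [← Int.card_Icc]
    refine Finset.card_bij' (fun s _ => s.2) (fun y _ => (m + p, y)) ?_ ?_ ?_ ?_
    · rintro ⟨a, b⟩ h; rw [Finset.mem_filter] at h; obtain ⟨h, h'⟩ := h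
      simp only at h'; subst h'
      exact Finset.mem_Icc.2 ((hC b).1 h)
    · intro y hy; exact Finset.mem_filter.2 ⟨(hC y).2 (Finset.mem_Icc.1 hy), rfl⟩
    · rintro ⟨a, b⟩ h; rw [Finset.mem_filter] at h; obtain ⟨h, h'⟩ := h
      simp only at h'; subst h'; rfl
    · intro y hy; rfl
  have hAm : toR (m, u0) ∈ P := (hS _).2 ((hU _).2 ⟨le_rfl, hu⟩)
  have hA1m : toR (m, u1) ∈ P := (hS _).2 ((hU _).2 ⟨hu, le_rfl⟩)
  have hCm : toR (m + p, c0) ∈ P := (hS _).2 ((hC _).2 ⟨le_rfl, hc⟩)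
  have hC1m : toR (m + p, c1) ∈ P := (hS _).2 ((hC _).2 ⟨hc, le_rfl⟩)
  have hmid : (F.filter (fun s => m < s.1 ∧ s.1 < m + p)).card ≤ 2 * (p - 1).toNat := by
    have e : (Finset.Ioo m (m + p)).card = (p - 1).toNat := by
      rw [Int.card_Ioo]; congr 1; ring
    rw [← e]
    apply Finset.card_le_mul_card_image_of_maps_to (f := Prod.fst)
    · intro s hs; exact Finset.mem_Ioo.2 (Finset.mem_filter.1 hs).2
    · intro x hx
      rw [Finset.mem_Ioo] at hx
      set Q := (F.filter (fun s => m < s.1 ∧ s.1 < m + p)).filter (fun a => a.1 = x) with hQ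
      have : Q.card = (Q.image Prod.snd).card := by
        rw [Finset.card_image_of_injOn]
        rintro ⟨a, b⟩ h ⟨a', b'⟩ h' hh
        have h1 := (Finset.mem_filter.1 h).2
        have h2 := (Finset.mem_filter.1 h').2
        simp only at h1 h2 hh
        rw [h1, h2, hh]
      rw [this]
      apply col_card hconv (x := x)
      · apply int_at hconv hint hAm hCm
        · simp only [toR]; exact_mod_cast hx.1
        · simp only [toR]; exact_mod_cast hx.2
      · intro y hy
        obtain ⟨⟨a, b⟩, h, rfl⟩ := Finset.mem_image.1 hy
        obtain ⟨h1, h2⟩ := Finset.mem_filter.1 h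
        simp only at h2; subst h2
        have h3 := Finset.mem_filter.1 (Finset.mem_filter.1 h1).1
        exact ⟨(hS _).2 h3.1, h3.2⟩
  have hb : (F.card : ℤ) ≤ (u1 - u0) + (c1 - c0) + 2 * p := by
    have hsub : F ⊆ (S.filter (fun s => s.1 = m)) ∪ (S.filter (fun s => s.1 = m + p)) ∪
        (F.filter (fun s => m < s.1 ∧ s.1 < m + p)) := by
      intro s hs
      have hsS := (Finset.mem_filter.1 hs).1
      have := h0 s hsS
      simp only [Finset.mem_union, Finset.mem_filter]
      by_cases h1 : s.1 = m
      · exact Or.inl (Or.inl ⟨hsS, h1⟩)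
      by_cases h2 : s.1 = m + p
      · exact Or.inl (Or.inr ⟨hsS, h2⟩)
      · exact Or.inr ⟨hs, by omega, by omega⟩
    have h1 := Finset.card_le_card hsub
    have h2 := Finset.card_union_le ((S.filter (fun s => s.1 = m)) ∪ (S.filter (fun s => s.1 = m + p)))
        (F.filter (fun s => m < s.1 ∧ s.1 < m + p))
    have h3 := Finset.card_union_le (S.filter (fun s => s.1 = m)) (S.filter (fun s => s.1 = m + p))
    omega
  have hbr : (F.card : ℝ) ≤ (u1 - u0) + (c1 - c0) + 2 * p := by exact_mod_cast hb
  -- area bounds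
  set V := (volume P).toReal with hV
  have hquad : ∀ a ∈ P, ∀ c ∈ P, ∀ y ∈ P, ∀ y' ∈ P, (det3 a c y - det3 a c y') / 2 ≤ V := by
    intro a ha c hc' y hy y' hy'
    exact (ENNReal.ofReal_le_iff_le_toReal hfin).1 (quad hconv ha hc' hy hy')
  have htrap : (p : ℝ) * ((u1 - u0) + (c1 - c0)) / 2 ≤ V := by
    have := hquad _ hAm _ hC1m _ hA1m _ hCm
    simp only [det3, toR] at *
    push_cast at *
    nlinarith
  have hur : (u0 : ℝ) ≤ u1 := by exact_mod_cast hu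
  have hcr' : (c0 : ℝ) ≤ c1 := by exact_mod_cast hc
  have hexact : (∀ s ∈ S, p * u0 + (c0 - u0) * (s.1 - m) ≤ p * s.2 ∧
      p * s.2 ≤ p * u1 + (c1 - u1) * (s.1 - m)) → V = (p : ℝ) * ((u1 - u0) + (c1 - c0)) / 2 := by
    intro h
    apply le_antisymm _ htrap
    have hn : (0 : ℝ) ≤ (p : ℝ) * ((u1 - u0) + (c1 - c0)) / 2 := by
      have : (0 : ℝ) ≤ (u1 - u0) + (c1 - c0) := by linarith
      positivity
    apply ENNReal.toReal_le_of_le_ofReal hn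
    apply trap_upper (m : ℝ) p u0 u1 c0 c1 hpr hur hcr' hclosed.measurableSet
    intro z hz
    refine ⟨(hbx z hz).1, (hbx z hz).2, ?_, ?_⟩
    · have := hull_le hP (c0 - u0) (-p) ((c0 - u0) * m - p * u0) (by
        intro s hs
        have := (h s hs).1
        have : (p * u0 + (c0 - u0) * (s.1 - m) : ℝ) ≤ p * s.2 := by exact_mod_cast this
        linarith) z hz
      linarith
    · have := hull_le hP (-(c1 - u1)) p (-(c1 - u1) * m + p * u1) (by
        intro s hs
        have := (h s hs).2
        have : (p * s.2 : ℝ) ≤ p * u1 + (c1 - u1) * (s.1 - m) := by exact_mod_cast this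
        linarith) z hz
      linarith
  -- outside the trapezoid
  have hout : (∃ s ∈ S, ¬ (p * u0 + (c0 - u0) * (s.1 - m) ≤ p * s.2 ∧
      p * s.2 ≤ p * u1 + (c1 - u1) * (s.1 - m))) →
      (p : ℝ) * ((u1 - u0) + (c1 - c0)) / 2 + 1 / 2 ≤ V := by
    rintro ⟨s, hs, hsn⟩
    have hsP := (hS s).2 hs
    set T : Set (ℝ × ℝ) := convexHull ℝ {toR (m, u0), toR (m, u1), toR (m + p, c0), toR (m + p, c1)} with hT
    have hTc : Convex ℝ T := convex_convexHull ℝ _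
    have hTP : T ⊆ P := by
      apply convexHull_min _ hconv
      intro z hz
      simp only [Set.mem_insert_iff, Set.mem_singleton_iff] at hz
      rcases hz with rfl | rfl | rfl | rfl <;> assumption
    have hTv : ENNReal.ofReal ((p : ℝ) * ((u1 - u0) + (c1 - c0)) / 2) ≤ volume T := by
      have := quad hTc (A := toR (m, u0)) (C := toR (m + p, c1)) (y := toR (m, u1)) (y' := toR (m + p, c0))
        (by apply subset_convexHull; simp) (by apply subset_convexHull; simp)
        (by apply subset_convexHull; simp) (by apply subset_convexHull; simp)
      convert this using 3
      simp only [det3, toR]; push_cast; ring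
    have hTl : ∀ α β c : ℝ, α * m + β * u0 ≤ c → α * m + β * u1 ≤ c → α * (m + p) + β * c0 ≤ c →
        α * (m + p) + β * c1 ≤ c → ∀ z ∈ T, α * z.1 + β * z.2 ≤ c := by
      intro α β c g1 g2 g3 g4
      apply hull_le (S := {(m, u0), (m, u1), (m + p, c0), (m + p, c1)}) (P := T)
      · rw [hT]; simp [Set.image_insert_eq]
      · intro w hw
        simp only [Finset.mem_insert, Finset.mem_singleton] at hw
        rcases hw with rfl | rfl | rfl | rfl <;> push_cast <;> assumption
    suffices h : ENNReal.ofReal ((p : ℝ) * ((u1 - u0) + (c1 - c0)) / 2) + ENNReal.ofReal (1 / 2) ≤ volume P by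
      rw [← ENNReal.ofReal_add _ (by norm_num), ENNReal.ofReal_le_iff_le_toReal hfin] at h
      · exact h
      · have : (0 : ℝ) ≤ (u1 - u0) + (c1 - c0) := by linarith
        positivity
    rw [not_and_or, not_le, not_le] at hsn
    rcases hsn with hsn | hsn
    · have hd : 1 ≤ det3 (toR (m + p, c0)) (toR (m, u0)) (toR s) := by
        have : p * s.2 + 1 ≤ p * u0 + (c0 - u0) * (s.1 - m) := hsn
        have : (p * s.2 + 1 : ℝ) ≤ p * u0 + (c0 - u0) * (s.1 - m) := by exact_mod_cast this
        simp only [det3, toR]; push_cast; linarith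
      refine le_trans (add_le_add hTv (ENNReal.ofReal_le_ofReal ?_)) 
        (add_tri hconv hTP hCm hAm hsP ?_ (by linarith))
      · linarith
      · intro z hz
        have := hTl (c0 - u0) (-p) ((c0 - u0) * m - p * u0) (by linarith) (by nlinarith) (by linarith) (by nlinarith) z hz
        simp only [det3, toR]; push_cast; linarith
    · have hd : 1 ≤ det3 (toR (m, u1)) (toR (m + p, c1)) (toR s) := by
        have : p * u1 + (c1 - u1) * (s.1 - m) + 1 ≤ p * s.2 := hsn
        have : (p * u1 + (c1 - u1) * (s.1 - m) + 1 : ℝ) ≤ p * s.2 := by exact_mod_cast this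
        simp only [det3, toR]; push_cast; linarith
      refine le_trans (add_le_add hTv (ENNReal.ofReal_le_ofReal ?_)) 
        (add_tri hconv hTP hA1m hC1m hsP ?_ (by linarith))
      · linarith
      · intro z hz
        have := hTl (-(c1 - u1)) p (-(c1 - u1) * m + p * u1) (by nlinarith) (by linarith) (by nlinarith) (by linarith) z hz
        simp only [det3, toR]; push_cast; linarith
  -- case analysis
  have hn0 : 0 ≤ (u1 - u0) + (c1 - c0) := by omega
  have hn1 : (u1 - u0) + (c1 - c0) = c1 - u0 - (c0 - u1) := by ring
  obtain ⟨n, hn⟩ : ∃ n, n = (u1 - u0) + (c1 - c0) := ⟨_, rfl⟩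
  have hnr : (n : ℝ) = (u1 - u0) + (c1 - c0) := by exact_mod_cast hn
  rw [← hn] at hb hn0
  rw [← hnr] at hbr htrap hexact hout
  by_cases hp1 : p = 1
  · subst hp1
    left
    refine ⟨?_, hb3'⟩
    have hV1 : V = ((1 : ℤ) : ℝ) * n / 2 := by
      apply hexact
      rintro ⟨a, b⟩ hs
      have h1 := h0 _ hs
      simp only at h1 ⊢
      rcases (by omega : a = m ∨ a = m + 1) with rfl | rfl
      · have := (hU b).1 hs
        constructor <;> linarith
      · have := (hC b).1 hs
        constructor <;> linarith
    have hFS : F.card = (u1 + 1 - u0).toNat + (c1 + 1 - c0).toNat := by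
      rw [← hcl, ← hcr, ← Finset.card_union_of_disjoint]
      · congr 1
        ext ⟨a, b⟩
        simp only [Finset.mem_union, Finset.mem_filter]
        constructor
        · intro h
          have hS' := (Finset.mem_filter.1 h).1
          have := h0 _ hS'
          simp only at this
          rcases (by omega : a = m ∨ a = m + 1) with rfl | rfl
          · exact Or.inl ⟨hS', rfl⟩
          · exact Or.inr ⟨hS', rfl⟩
        · rintro (⟨h, rfl⟩ | ⟨h, rfl⟩)
          · exact hfl b ((hU b).1 h).1 ((hU b).1 h).2
          · exact hfr b ((hC b).1 h).1 ((hC b).1 h).2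
      · rw [Finset.disjoint_left]
        intro s h h'
        have := (Finset.mem_filter.1 h).2
        have := (Finset.mem_filter.1 h').2
        omega
    have : (F.card : ℤ) = n + 2 := by omega
    have : (F.card : ℝ) = n + 2 := by exact_mod_cast this
    rw [hV1, this]; push_cast; ring
  right
  have hp2 : 2 ≤ p := by omega
  have hp2r : (2 : ℝ) ≤ p := by exact_mod_cast hp2
  by_cases hbig : p = 2 ∨ 4 ≤ n
  · left
    refine ⟨?_, hb3'⟩
    have : 0 ≤ ((n : ℝ) - 4) * (p - 2) := by
      rcases hbig with h | h
      · rw [h]; simp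
      · have : (4 : ℝ) ≤ n := by exact_mod_cast h
        apply mul_nonneg <;> linarith
    nlinarith
  push Not at hbig
  have hp3 : 3 ≤ p := by omega
  have hn3 : n ≤ 3 := by omega
  obtain ⟨k, t, ht1, ht2, hδ⟩ := shear_exists p (c0 - u1) n hp hn0 (by omega)
  obtain ⟨u, w, hu', hw', htw⟩ : ∃ u w : ℤ, (u0 ≤ u ∧ u ≤ u1) ∧ (c0 ≤ w ∧ w ≤ c1) ∧ t = w - u := by
    by_cases h : t + u1 ≤ c1
    · exact ⟨u1, t + u1, by omega, by omega, by omega⟩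
    · exact ⟨c1 - t, c1, by omega, by omega, by omega⟩
  obtain ⟨s, hs, s', hs', hw⟩ := hmin k
  have hq := hquad _ ((hS _).2 ((hU u).2 hu')) _ ((hS _).2 ((hC w).2 hw')) _ ((hS _).2 hs') _ ((hS _).2 hs)
  have hz : p * p - |t + k * p| * p ≤ p * (s'.2 - s.2) - (w - u) * (s'.1 - s.1) := by
    have e : p * (s'.2 - s.2) - (w - u) * (s'.1 - s.1) =
        p * ((s'.2 + k * s'.1) - (s.2 + k * s.1)) - (t + k * p) * (s'.1 - s.1) := by
      rw [htw]; ring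
    rw [e]
    have e1 : |s'.1 - s.1| ≤ p := by
      have := h0 _ hs; have := h0 _ hs'
      rw [abs_le]; constructor <;> omega
    have e2 : (t + k * p) * (s'.1 - s.1) ≤ |t + k * p| * p := by
      refine (le_abs_self _).trans ?_
      rw [abs_mul]
      exact mul_le_mul_of_nonneg_left e1 (abs_nonneg _)
    have e3 := mul_le_mul_of_nonneg_left hw hp.le
    linarith
  obtain ⟨d, hd⟩ : ∃ d, d = |t + k * p| := ⟨_, rfl⟩
  rw [← hd] at hz hδ
  have hd0 : 0 ≤ d := by rw [hd]; exact abs_nonneg _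
  have hV2 : (p * p - d * p : ℝ) / 2 ≤ V := by
    refine le_trans ?_ hq
    have : (p * p - d * p : ℝ) ≤ p * (s'.2 - s.2) - (w - u) * (s'.1 - s.1) := by exact_mod_cast hz
    simp only [det3, toR]; push_cast
    linarith
  have hδr : (2 * d : ℝ) ≤ p - n := by exact_mod_cast hδ
  have hn0r : (0 : ℝ) ≤ n := by exact_mod_cast hn0
  by_cases hp4 : 4 ≤ p
  · left
    refine ⟨?_, hb3'⟩
    have hp4r : (4 : ℝ) ≤ p := by exact_mod_cast hp4
    nlinarith [mul_nonneg hpr.le (sub_nonneg.2 hδr), mul_nonneg hn0r (sub_nonneg.2 hp4r), sq_nonneg ((p : ℝ) - 4)]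
  have hp3' : p = 3 := by omega
  subst hp3'
  by_cases hn2 : n ≤ 1
  · left
    refine ⟨?_, hb3'⟩
    have : (n : ℝ) ≤ 1 := by exact_mod_cast hn2
    push_cast at *
    linarith
  have hd0' : d = 0 := by omega
  subst hd0'
  by_cases hb8 : F.card ≤ 8
  · left
    refine ⟨?_, hb3'⟩
    have : (F.card : ℝ) ≤ 8 := by exact_mod_cast hb8
    push_cast at *
    linarith
  have hn3' : n = 3 := by omega
  have hb9 : F.card = 9 := by omega
  subst hn3'
  rw [hb9]
  by_cases hall : ∀ s ∈ S, 3 * u0 + (c0 - u0) * (s.1 - m) ≤ 3 * s.2 ∧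
      3 * s.2 ≤ 3 * u1 + (c1 - u1) * (s.1 - m)
  · right
    have := hexact hall
    rw [this]; norm_num
  · left
    have := hout (by
      by_contra hcon
      apply hall
      intro s hs
      by_contra h
      exact hcon ⟨s, hs, h⟩)
    push_cast at *
    constructor <;> linarith

noncomputable def linH (a b c d : ℝ) (h : a * d - b * c = 1) : (ℝ × ℝ) ≃ₜ (ℝ × ℝ) where
  toFun := lin a b c d
  invFun := lin d (-b) (-c) a
  left_inv z := by
    rw [lin_apply, lin_apply]
    ext
    · simp only; linear_combination z.1 * h
    · simp only; linear_combination z.2 * h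
  right_inv z := by
    rw [lin_apply, lin_apply]
    ext
    · simp only; linear_combination z.1 * h
    · simp only; linear_combination z.2 * h
  continuous_toFun := (lin a b c d).continuous_of_finiteDimensional
  continuous_invFun := (lin d (-b) (-c) a).continuous_of_finiteDimensional

lemma linH_coe (a b c d : ℝ) (h : a * d - b * c = 1) : ⇑(linH a b c d h) = lin a b c d := rfl

def gmap (a b c d : ℤ) (s : ℤ × ℤ) : ℤ × ℤ := (a * s.1 + b * s.2, c * s.1 + d * s.2)

lemma gmap_inv {a b c d : ℤ} (h : a * d - b * c = 1) (s : ℤ × ℤ) :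
    gmap a b c d (gmap d (-b) (-c) a s) = s := by
  simp only [gmap]
  ext
  · simp only; linear_combination s.1 * h
  · simp only; linear_combination s.2 * h

lemma gmap_inv' {a b c d : ℤ} (h : a * d - b * c = 1) (s : ℤ × ℤ) :
    gmap d (-b) (-c) a (gmap a b c d s) = s := by
  simp only [gmap]
  ext
  · simp only; linear_combination s.1 * h
  · simp only; linear_combination s.2 * h

lemma toR_gmap (a b c d : ℤ) (s : ℤ × ℤ) : toR (gmap a b c d s) = lin a b c d (toR s) := by
  rw [lin_apply]; simp [toR, gmap]

lemma mem_image_lin {a b c d : ℤ} (h : a * d - b * c = 1) (Q : Set (ℝ × ℝ)) (z : ℤ × ℤ) :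
    toR z ∈ lin a b c d '' Q ↔ toR (gmap d (-b) (-c) a z) ∈ Q := by
  have hr : (a * d - b * c : ℝ) = 1 := by exact_mod_cast h
  have hinj := (linH a b c d hr).injective
  rw [linH_coe] at hinj
  conv_lhs => rw [← gmap_inv h z, toR_gmap]
  exact hinj.mem_set_image

lemma Concl_transfer {a b c d : ℤ} (h : a * d - b * c = 1) (P : Set (ℝ × ℝ))
    (hc : Concl (lin a b c d '' P)) : Concl P := by
  have hr : (a * d - b * c : ℝ) = 1 := by exact_mod_cast h
  have hv : volume (lin a b c d '' P) = volume P := by rw [vol_lin, hr]; simp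
  have hf : {p : ℤ × ℤ | toR p ∈ frontier (lin a b c d '' P)} =
      gmap a b c d '' {p : ℤ × ℤ | toR p ∈ frontier P} := by
    have := (linH a b c d hr).image_frontier P
    rw [linH_coe] at this
    rw [← this]
    ext z
    simp only [Set.mem_ofPred_eq, Set.mem_image_iff_of_inverse (gmap_inv' h) (gmap_inv h)]
    exact mem_image_lin h _ z
  have hn : {p : ℤ × ℤ | toR p ∈ frontier (lin a b c d '' P)}.ncard =
      {p : ℤ × ℤ | toR p ∈ frontier P}.ncard := by
    rw [hf, Set.ncard_image_of_injective]
    exact (Function.LeftInverse.injective (gmap_inv' h))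
  rw [Concl, hv, hn] at hc
  exact hc

lemma main_aux (S : Finset (ℤ × ℤ)) (P : Set (ℝ × ℝ))
    (hP : P = convexHull ℝ (toR '' (S : Set (ℤ × ℤ)))) (hS : ∀ z, toR z ∈ P ↔ z ∈ S)
    (hint : (interior P).Nonempty) : Concl P := by
  classical
  have hne : S.Nonempty := by
    by_contra hcon
    rw [Finset.not_nonempty_iff_eq_empty] at hcon
    rw [hP, hcon] at hint
    simp at hint
  set N : ℕ → Prop := fun n => ∃ a b c d : ℤ, a * d - b * c = 1 ∧ ∃ m : ℤ,
    (∀ s ∈ S, m ≤ a * s.1 + b * s.2 ∧ a * s.1 + b * s.2 ≤ m + n) ∧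
    (∃ s ∈ S, a * s.1 + b * s.2 = m) ∧ (∃ s ∈ S, a * s.1 + b * s.2 = m + n) with hN
  have hex : ∀ a b c d : ℤ, a * d - b * c = 1 → ∃ n : ℕ, N n ∧
      ∃ s ∈ S, ∃ t ∈ S, (n : ℤ) = (a * t.1 + b * t.2) - (a * s.1 + b * s.2) := by
    intro a b c d h
    obtain ⟨s, hs, hsm⟩ := S.exists_min_image (fun s => a * s.1 + b * s.2) hne
    obtain ⟨t, ht, htm⟩ := S.exists_max_image (fun s => a * s.1 + b * s.2) hne
    have e : (((a * t.1 + b * t.2) - (a * s.1 + b * s.2)).toNat : ℤ) =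
        (a * t.1 + b * t.2) - (a * s.1 + b * s.2) :=
      Int.toNat_of_nonneg (by have := hsm t ht; linarith)
    refine ⟨((a * t.1 + b * t.2) - (a * s.1 + b * s.2)).toNat,
      ⟨a, b, c, d, h, a * s.1 + b * s.2, ?_, ⟨s, hs, rfl⟩, ⟨t, ht, by rw [e]; ring⟩⟩, s, hs, t, ht, e⟩
    intro w hw
    rw [e]
    exact ⟨hsm w hw, by have := htm w hw; linarith⟩
  have hexN : ∃ n, N n := by
    obtain ⟨n, hn, _⟩ := hex 1 0 0 1 (by norm_num)
    exact ⟨n, hn⟩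
  have hmin := fun n => @Nat.find_min' N _ hexN n
  obtain ⟨a, b, c, d, h, m, hb, hl, hr⟩ := Nat.find_spec hexN
  set p := Nat.find hexN
  have hrr : (a * d - b * c : ℝ) = 1 := by exact_mod_cast h
  apply Concl_transfer h
  apply core_s17 (S.image (gmap a b c d)) _ _ _ _ m p
  · intro s hs
    obtain ⟨w, hw, rfl⟩ := Finset.mem_image.1 hs
    exact hb w hw
  · obtain ⟨s, hs, e⟩ := hl
    exact ⟨_, Finset.mem_image_of_mem _ hs, e⟩
  · obtain ⟨s, hs, e⟩ := hr
    exact ⟨_, Finset.mem_image_of_mem _ hs, e⟩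
  · intro k
    obtain ⟨n, hn, s, hs, t, ht, e⟩ := hex (c + k * a) (d + k * b) (-a) (-b) (by linear_combination h)
    refine ⟨_, Finset.mem_image_of_mem _ hs, _, Finset.mem_image_of_mem _ ht, ?_⟩
    have h1 : (p : ℤ) ≤ n := by exact_mod_cast hmin n hn
    simp only [gmap]
    linarith
  · rw [hP, LinearMap.image_convexHull]
    congr 1
    rw [Finset.coe_image, Set.image_image, Set.image_image]
    simp only [toR_gmap]
  · intro z
    rw [mem_image_lin h, hS, Finset.mem_image]
    constructor
    · intro h'; exact ⟨_, h', gmap_inv h z⟩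
    · rintro ⟨s, hs, rfl⟩; rw [gmap_inv' h]; exact hs
  · have := (linH a b c d hrr).image_interior P
    rw [linH_coe] at this
    rw [← this]
    exact hint.image _

lemma lattice_fin {P : Set (ℝ × ℝ)} (hP : IsCompact P) : {z : ℤ × ℤ | toR z ∈ P}.Finite := by
  obtain ⟨R, hR⟩ := hP.isBounded.exists_norm_le
  apply (Set.finite_Icc ((-⌈R⌉, -⌈R⌉) : ℤ × ℤ) (⌈R⌉, ⌈R⌉)).subset
  intro z hz
  have h := hR _ hz
  rw [Prod.norm_def, max_le_iff, Real.norm_eq_abs, Real.norm_eq_abs, abs_le, abs_le] at h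
  have hc := Int.le_ceil R
  simp only [toR] at h
  obtain ⟨⟨h1, h2⟩, h3, h4⟩ := h
  simp only [Set.mem_Icc, Prod.le_def]
  refine ⟨⟨?_, ?_⟩, ?_, ?_⟩ <;> (rw [← Int.cast_le (R := ℝ)]; push_cast; linarith)

/-- Scott's inequality: for a convex lattice polygon `P` with
area `A(P)` and `B(P)` lattice points on its boundary, writing `b = ½B(P)`,
one of the following holds: (1) `A(P) + 1 = b ≥ 3/2` (no interior lattice
points); (2) `b ≤ A(P)/2 + 2` and `b ≥ 3/2`; (3) `(A(P), b) = (9/2, 9/2)`. -/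
theorem stmt17 (S : Finset (ℤ × ℤ)) (P : Set (ℝ × ℝ))
    (hP : P = convexHull ℝ (toR '' (S : Set (ℤ × ℤ))))
    (hint : (interior P).Nonempty) :
    (((volume P).toReal + 1 = ({p : ℤ × ℤ | toR p ∈ frontier P}.ncard : ℝ) / 2) ∧
        3 / 2 ≤ ({p : ℤ × ℤ | toR p ∈ frontier P}.ncard : ℝ) / 2) ∨
    ((({p : ℤ × ℤ | toR p ∈ frontier P}.ncard : ℝ) / 2 ≤ (volume P).toReal / 2 + 2) ∧
        3 / 2 ≤ ({p : ℤ × ℤ | toR p ∈ frontier P}.ncard : ℝ) / 2) ∨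
    ((volume P).toReal = 9 / 2 ∧
        ({p : ℤ × ℤ | toR p ∈ frontier P}.ncard : ℝ) / 2 = 9 / 2) := by
  have hcomp : IsCompact P := by
    rw [hP]; exact ((S.finite_toSet.image _).isCompact_convexHull ℝ)
  have hL := lattice_fin hcomp
  refine main_aux hL.toFinset P ?_ (by intro z; simp) hint
  rw [Set.Finite.coe_toFinset]
  apply Set.Subset.antisymm
  · conv_lhs => rw [hP]
    apply convexHull_mono
    apply Set.image_mono
    intro s hs
    show toR s ∈ P
    rw [hP]
    exact subset_convexHull _ _ ⟨s, hs, rfl⟩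
  · apply convexHull_min
    · rintro _ ⟨s, hs, rfl⟩; exact hs
    · rw [hP]; exact convex_convexHull ℝ _
end
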